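/- arXiv:1607.04322 — 2 statements merged into one kernel-verified Lean document; each statement's English description precedes it below -/
import Mathlib

section
/- Let (𝒜, μ_A) be a finite probability space with minimum nonzero atom probability α = α(μ_A) ≤ 1/2, let P : 𝒜^n → ℝ have degree at most d, let H ⊆ [n] with T = [n]∖H, and let i ∈ T. Then the L²-norm, over ξ ∼ μ_A^{⊗H}, of the function ξ ↦ Inf_i(P_ξ) is at most C₄(α)^d · Inf_i(P); that is, (E_{ξ∼μ_A^{⊗H}}[Inf_i(P_ξ)²])^{1/2} ≤ C₄(α)^d · Inf_i(P). -/
open Finset MeasureTheory ProbabilityTheory Filter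
open scoped Classical

noncomputable section

namespace NIS

/-- Expectation of `f` under the weight function `p` on a finite type. -/
def pmean {Ω : Type*} [Fintype Ω] (p : Ω → ℝ) (f : Ω → ℝ) : ℝ := ∑ ω, p ω * f ω

/-- Variance of `f` under the weight function `p` on a finite type. -/
def pvar {Ω : Type*} [Fintype Ω] (p : Ω → ℝ) (f : Ω → ℝ) : ℝ :=
  pmean p (fun ω => (f ω - pmean p f) ^ 2)

/-- `p` is a probability distribution on the finite type `Ω`. -/
def IsDist {Ω : Type*} [Fintype Ω] (p : Ω → ℝ) : Prop :=
  (∀ ω, 0 ≤ p ω) ∧ ∑ ω, p ω = 1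

/-- Probability of the event `E` under the weight function `p`. -/
def pprob {Ω : Type*} [Fintype Ω] (p : Ω → ℝ) (E : Ω → Prop) : ℝ :=
  ∑ ω, if E ω then p ω else 0

/-- Total variation distance between two distributions on a finite type. -/
def tvDist {Ω : Type*} [Fintype Ω] (p q : Ω → ℝ) : ℝ := (1 / 2) * ∑ ω, |p ω - q ω|

/-- Marginal on the first coordinate of a joint distribution. -/
def marginalA {A B : Type*} [Fintype A] [Fintype B] (μ : A × B → ℝ) : A → ℝ :=
  fun a => ∑ b, μ (a, b)

/-- Marginal on the second coordinate of a joint distribution. -/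
def marginalB {A B : Type*} [Fintype A] [Fintype B] (μ : A × B → ℝ) : B → ℝ :=
  fun b => ∑ a, μ (a, b)

/-- The Hirschfeld–Gebelein–Rényi maximal correlation of a finite joint distribution. -/
def maxCorr {A B : Type*} [Fintype A] [Fintype B] (μ : A × B → ℝ) : ℝ :=
  sSup { r | ∃ f : A → ℝ, ∃ g : B → ℝ,
    pmean (marginalA μ) f = 0 ∧ pmean (marginalB μ) g = 0 ∧
    pvar (marginalA μ) f = 1 ∧ pvar (marginalB μ) g = 1 ∧
    pmean μ (fun ab => f ab.1 * g ab.2) = r }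

/-- `n`-fold product distribution of a distribution `μA` on `A`. -/
def prodDist {A : Type*} [Fintype A] (μA : A → ℝ) (n : ℕ) : (Fin n → A) → ℝ :=
  fun x => ∏ i, μA (x i)

/-- `n`-fold product of a joint distribution `μ` on `A × B`, identified with a distribution on
`A^n × B^n`. -/
def prodPair {A B : Type*} [Fintype A] [Fintype B] (μ : A × B → ℝ) (n : ℕ) :
    (Fin n → A) × (Fin n → B) → ℝ :=
  fun p => ∏ i, μ (p.1 i, p.2 i)

/-- The influence of coordinate `i` on `f : A^n → ℝ` with respect to `μA^{⊗n}`: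
`Inf_i(f) = E_{x_{-i}}[Var_{x_i} f] = ½ E_{x, a}[(f(x) - f(x_i ← a))²]`. -/
def influence {A : Type*} [Fintype A] {n : ℕ} (μA : A → ℝ) (i : Fin n)
    (f : (Fin n → A) → ℝ) : ℝ :=
  (1 / 2) * ∑ x : Fin n → A, ∑ a : A,
    (∏ j, μA (x j)) * μA a * (f x - f (Function.update x i a)) ^ 2

/-- Total influence of `f`. -/
def totalInfluence {A : Type*} [Fintype A] {n : ℕ} (μA : A → ℝ)
    (f : (Fin n → A) → ℝ) : ℝ :=
  ∑ i, influence μA i f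

/-- `g` depends on at most `d` coordinates. -/
def DependsOnLE {A : Type*} {n : ℕ} (d : ℕ) (g : (Fin n → A) → ℝ) : Prop :=
  ∃ J : Finset (Fin n), J.card ≤ d ∧
    ∀ x y : Fin n → A, (∀ i ∈ J, x i = y i) → g x = g y

/-- `f` has degree at most `d`: it lies in the linear span of functions each depending on at
most `d` coordinates. -/
def degLE {A : Type*} {n : ℕ} (d : ℕ) (f : (Fin n → A) → ℝ) : Prop :=
  f ∈ Submodule.span ℝ { g : (Fin n → A) → ℝ | DependsOnLE d g }

/-- Restriction of `P` fixing the coordinates in `H` to the values of `ξ`; the result only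
depends on the coordinates outside `H`. -/
def restrictFn {A : Type*} {n : ℕ} (H : Finset (Fin n)) (ξ : Fin n → A)
    (P : (Fin n → A) → ℝ) : (Fin n → A) → ℝ :=
  fun x => P (fun i => if i ∈ H then ξ i else x i)

/-- The 2-dimensional Gaussian distribution `G(ρ)` with standard normal marginals and
correlation `ρ`. -/
def gauss2 (ρ : ℝ) : Measure (ℝ × ℝ) :=
  Measure.map (fun p : ℝ × ℝ => (p.1, ρ * p.1 + Real.sqrt (1 - ρ ^ 2) * p.2))
    ((gaussianReal 0 1).prod (gaussianReal 0 1))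

/-- The standard normal cumulative distribution function `Φ`. -/
def stdNormalCDF (t : ℝ) : ℝ := ((gaussianReal 0 1) (Set.Iic t)).toReal

/-- The inverse `Φ⁻¹` of the standard normal CDF (junk values outside `(0,1)`). -/
def stdNormalCDFInv : ℝ → ℝ := Function.invFun stdNormalCDF

/-- The ±1-valued threshold function: `thr t r = 1` if `r ≥ t`, and `-1` otherwise. -/
def thr (t r : ℝ) : ℝ := if t ≤ r then 1 else -1

/-- The Gaussian stability quantity `Γ̄_ρ(m, v)`. -/
def Gammabar (ρ m v : ℝ) : ℝ :=
  ∫ q : ℝ × ℝ, (if q.1 ≤ stdNormalCDFInv ((1 + m) / 2) then (1 : ℝ) else -1) *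
    (if q.2 ≤ stdNormalCDFInv ((1 + v) / 2) then (1 : ℝ) else -1) ∂(gauss2 ρ)

/-- Pushforward of `μ^{⊗n}` under the pair of maps `(f, g)`. -/
def push {A B U V : Type*} [Fintype A] [Fintype B] (μ : A × B → ℝ) (n : ℕ)
    (f : (Fin n → A) → U) (g : (Fin n → B) → V) : U × V → ℝ :=
  fun uv => ∑ z : Fin n → A × B,
    if f (fun i => (z i).1) = uv.1 ∧ g (fun i => (z i).2) = uv.2
    then ∏ i, μ (z i) else 0

/-- `ν` can be non-interactively simulated from `μ`. -/
def CanSimulate {A B U V : Type*} [Fintype A] [Fintype B] [Fintype U] [Fintype V]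
    (μ : A × B → ℝ) (ν : U × V → ℝ) : Prop :=
  ∃ f : (n : ℕ) → (Fin n → A) → U, ∃ g : (n : ℕ) → (Fin n → B) → V,
    Tendsto (fun n => tvDist (push μ n (f n) (g n)) ν) atTop (nhds 0)

/-- The doubly symmetric binary source `DSBS(ρ)`, as a distribution on `Bool × Bool`, where
`true` encodes `+1` and `false` encodes `-1`. -/
def DSBS (ρ : ℝ) : Bool × Bool → ℝ :=
  fun bv => if bv.1 = bv.2 then (1 + ρ) / 4 else (1 - ρ) / 4

/-- The ±1 value encoded by a Boolean. -/
def sgn (b : Bool) : ℝ := if b then 1 else -1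

/-- Minimum nonzero probability of an atom. -/
def minAtom {A : Type*} [Fintype A] (μA : A → ℝ) : ℝ :=
  sInf { x | ∃ a, μA a = x ∧ 0 < x }

/-- The hypercontractivity constant `C₄(α)`. -/
def C4 (α : ℝ) : ℝ :=
  if α = 1 / 2 then 3 else
    (((1 - α) / α) ^ ((3 : ℝ) / 4) - ((1 - α) / α) ^ (-((3 : ℝ) / 4))) /
    (((1 - α) / α) ^ ((1 : ℝ) / 4) - ((1 - α) / α) ^ (-((1 : ℝ) / 4)))

/-! ### Elementary inequalities -/

lemma linear_coeff_eq_zero_of_quartic_nonneg {a b c e : ℝ}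
    (h : ∀ t : ℝ, 0 ≤ a * t + b * t ^ 2 + c * t ^ 3 + e * t ^ 4) : a = 0 := by
  have hd : HasDerivAt (fun t : ℝ => a * t + b * t ^ 2 + c * t ^ 3 + e * t ^ 4) a 0 := by
    have h1 := (((((hasDerivAt_id (0 : ℝ)).const_mul a).add
      ((hasDerivAt_pow 2 (0 : ℝ)).const_mul b)).add
      ((hasDerivAt_pow 3 (0 : ℝ)).const_mul c)).add
      ((hasDerivAt_pow 4 (0 : ℝ)).const_mul e))
    exact h1.congr_deriv (by norm_num)
  have hmin : IsLocalMin (fun t : ℝ => a * t + b * t ^ 2 + c * t ^ 3 + e * t ^ 4) 0 :=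
    Filter.Eventually.of_forall fun t => by simpa using h t
  exact hmin.hasDerivAt_eq_zero hd

/-- The two-point case of the `(2,4)`-hypercontractive inequality, in standardized form. -/
lemma two_point_standardized {p L g T : ℝ} (hL : 2 ≤ L) (hp : L ^ 2 * (p * (1 - p)) = 1) :
    p * (g + (1 - p) * (L * T)) ^ 4 + (1 - p) * (g - p * (L * T)) ^ 4
      ≤ (g ^ 2 + (1 + L) * T ^ 2) ^ 2 := by
  have key : (g ^ 2 + (1 + L) * T ^ 2) ^ 2
      - (p * (g + (1 - p) * (L * T)) ^ 4 + (1 - p) * (g - p * (L * T)) ^ 4)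
      = 2 * T ^ 2 * ((L - 2) * g ^ 2 - 2 * ((1 - 2 * p) * L) * g * T + (L + 2) * T ^ 2) := by
    linear_combination (-(6 * g ^ 2 * T ^ 2) - 4 * g * T ^ 3 * L * (1 - 2 * p)
      - T ^ 4 * (L ^ 2 - 3 * (L ^ 2 * (p * (1 - p)) + 1))) * hp
  have hsq : (L + 2) * ((L - 2) * g ^ 2 - 2 * ((1 - 2 * p) * L) * g * T + (L + 2) * T ^ 2)
      = ((1 - 2 * p) * L * g - (L + 2) * T) ^ 2 := by
    linear_combination (4 * g ^ 2) * hp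
  have hnn : 0 ≤ (L - 2) * g ^ 2 - 2 * ((1 - 2 * p) * L) * g * T + (L + 2) * T ^ 2 := by
    have h0 : 0 < L + 2 := by linarith
    refine nonneg_of_mul_nonneg_right ?_ h0
    rw [hsq]
    positivity
  have : 0 ≤ 2 * T ^ 2 * ((L - 2) * g ^ 2 - 2 * ((1 - 2 * p) * L) * g * T + (L + 2) * T ^ 2) := by
    positivity
  linarith

lemma two_le_one_div_sqrt {p : ℝ} (h0 : 0 < p) (h1 : p < 1) :
    2 ≤ 1 / √(p * (1 - p)) := by
  have hpos : 0 < p * (1 - p) := mul_pos h0 (by linarith)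
  rw [le_div_iff₀ (Real.sqrt_pos.mpr hpos)]
  have : √(p * (1 - p)) ≤ 1 / 2 := by
    rw [Real.sqrt_le_left (by norm_num)]
    nlinarith [sq_nonneg (2 * p - 1)]
  linarith

lemma two_point_fourth_moment_le {α p u v : ℝ} (hα : 0 < α) (hp : α ≤ p) (hp' : α ≤ 1 - p) :
    p * u ^ 4 + (1 - p) * v ^ 4
      ≤ ((1 + 1 / √(α * (1 - α))) * (p * u ^ 2 + (1 - p) * v ^ 2)
          - (1 / √(α * (1 - α))) * (p * u + (1 - p) * v) ^ 2) ^ 2 := by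
  have hpos : 0 < p * (1 - p) := mul_pos (by linarith) (by linarith)
  have hαpos : 0 < α * (1 - α) := mul_pos hα (by linarith)
  have hs : 0 < √(p * (1 - p)) := Real.sqrt_pos.mpr hpos
  have hs2 : √(p * (1 - p)) ^ 2 = p * (1 - p) := Real.sq_sqrt hpos.le
  have hmono : 1 / √(p * (1 - p)) ≤ 1 / √(α * (1 - α)) := by
    apply one_div_le_one_div_of_le (Real.sqrt_pos.mpr hαpos)
    apply Real.sqrt_le_sqrt
    nlinarith
  set lam := 1 / √(α * (1 - α))
  set s := √(p * (1 - p))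
  set L := 1 / s with hLdef
  have hL2 : 2 ≤ L := two_le_one_div_sqrt (by linarith) (by linarith)
  have hLs : L * s = 1 := by rw [hLdef]; field_simp
  have hLp : L ^ 2 * (p * (1 - p)) = 1 := by
    rw [← hs2, ← mul_pow, hLs, one_pow]
  have h := two_point_standardized (g := p * u + (1 - p) * v) (T := (u - v) * s) hL2 hLp
  have hu : p * u + (1 - p) * v + (1 - p) * (L * ((u - v) * s)) = u := by
    linear_combination (1 - p) * (u - v) * hLs
  have hv : p * u + (1 - p) * v - p * (L * ((u - v) * s)) = v := by
    linear_combination (-p * (u - v)) * hLs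
  rw [hu, hv] at h
  refine h.trans (pow_le_pow_left₀ (by positivity) ?_ 2)
  have hT : ((u - v) * s) ^ 2 = p * (1 - p) * (u - v) ^ 2 := by
    rw [mul_pow, hs2]; ring
  have hrw : (1 + lam) * (p * u ^ 2 + (1 - p) * v ^ 2) - lam * (p * u + (1 - p) * v) ^ 2
      = (p * u + (1 - p) * v) ^ 2 + (1 + lam) * ((u - v) * s) ^ 2 := by
    rw [hT]; ring
  rw [hrw]
  gcongr

/-! ### The one-variable inequality -/

lemma sum_update_eq {ι : Type*} [Fintype ι] (p f : ι → ℝ) (j : ι) (x : ℝ) (φ : ℝ → ℝ) :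
    ∑ k, p k * φ (Function.update f j x k)
      = ∑ k, p k * φ (f k) + p j * (φ x - φ (f j)) := by
  rw [← Finset.add_sum_erase _ _ (Finset.mem_univ j),
    ← Finset.add_sum_erase _ (fun k => p k * φ (f k)) (Finset.mem_univ j)]
  have : ∑ k ∈ univ.erase j, p k * φ (Function.update f j x k)
      = ∑ k ∈ univ.erase j, p k * φ (f k) :=
    Finset.sum_congr rfl fun k hk => by
      rw [Function.update_of_ne (Finset.ne_of_mem_erase hk)]
  rw [this, Function.update_self]
  ring

/-- Euler–Lagrange equation at a function where the quadratic form `C E[f²] - (C-1) E[f]²` is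
extremal relative to the fourth moment. -/
lemma euler_lagrange {ι : Type*} [Fintype ι] {p : ι → ℝ} (hp : ∀ j, 0 < p j) {C r : ℝ}
    (hr : ∀ f : ι → ℝ, r * ∑ k, p k * f k ^ 4
      ≤ (C * ∑ k, p k * f k ^ 2 - (C - 1) * (∑ k, p k * f k) ^ 2) ^ 2)
    {f : ι → ℝ} (hf : r * ∑ k, p k * f k ^ 4
      = (C * ∑ k, p k * f k ^ 2 - (C - 1) * (∑ k, p k * f k) ^ 2) ^ 2) (j : ι) :
    (C * ∑ k, p k * f k ^ 2 - (C - 1) * (∑ k, p k * f k) ^ 2)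
      * (C * f j - (C - 1) * ∑ k, p k * f k) = r * f j ^ 3 := by
  have h : ∀ t : ℝ, _ := fun t => hr (Function.update f j (f j + t))
  have e1 : ∀ t : ℝ, _ := fun t => sum_update_eq p f j (f j + t) (fun y => y)
  have e2 : ∀ t : ℝ, _ := fun t => sum_update_eq p f j (f j + t) (fun y => y ^ 2)
  have e4 : ∀ t : ℝ, _ := fun t => sum_update_eq p f j (f j + t) (fun y => y ^ 4)
  simp only [e1, e2, e4] at h
  set m4 := ∑ k, p k * f k ^ 4
  set m2 := ∑ k, p k * f k ^ 2
  set g := ∑ k, p k * f k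
  set v := f j
  set q := p j with hq
  set Q := C * m2 - (C - 1) * g ^ 2 with hQ
  have h0 := linear_coeff_eq_zero_of_quartic_nonneg
    (a := 4 * q * (Q * (C * v - (C - 1) * g) - r * v ^ 3))
    (b := (2 * q * (C * v - (C - 1) * g)) ^ 2 + 2 * Q * (C * q - (C - 1) * q ^ 2)
      - 6 * r * q * v ^ 2)
    (c := 2 * (2 * q * (C * v - (C - 1) * g)) * (C * q - (C - 1) * q ^ 2) - 4 * r * q * v)
    (e := (C * q - (C - 1) * q ^ 2) ^ 2 - r * q)
    (fun t => by
      have := h t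
      rw [hQ] at hf ⊢
      linarith)
  have hq0 : 4 * q ≠ 0 := by
    have := hp j
    positivity
  have := (mul_eq_zero.mp h0).resolve_left hq0
  linarith

/-- A function with at most two values satisfies the one-variable inequality. -/
lemma fourth_moment_le_of_two_values {ι : Type*} [Fintype ι] {p : ι → ℝ} {α : ℝ} (hα : 0 < α)
    (hp : ∀ j, α ≤ p j) (hsum : ∑ j, p j = 1) {f : ι → ℝ} {u v : ℝ}
    (huv : ∀ j, f j = u ∨ f j = v) :
    ∑ k, p k * f k ^ 4
      ≤ ((1 + 1 / √(α * (1 - α))) * ∑ k, p k * f k ^ 2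
          - (1 / √(α * (1 - α))) * (∑ k, p k * f k) ^ 2) ^ 2 := by
  have hconst : ∀ w, (∀ j, f j = w) → ∑ k, p k * f k ^ 4
      ≤ ((1 + 1 / √(α * (1 - α))) * ∑ k, p k * f k ^ 2
          - (1 / √(α * (1 - α))) * (∑ k, p k * f k) ^ 2) ^ 2 := by
    intro w hw
    simp only [hw, ← Finset.sum_mul, hsum]
    apply le_of_eq
    ring
  by_cases h1 : ∀ j, f j = u
  · exact hconst u h1
  by_cases h2 : ∀ j, f j = v
  · exact hconst v h2
  push Not at h1 h2
  obtain ⟨a, ha⟩ := h1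
  obtain ⟨b, hb⟩ := h2
  have hb' : f b = u := (huv b).resolve_right hb
  have hnn : ∀ j, 0 ≤ p j := fun j => hα.le.trans (hp j)
  set P := ∑ j with f j = u, p j with hP
  have hcompl : ∑ j with ¬ f j = u, p j = 1 - P := by
    rw [← hsum, hP, ← Finset.sum_filter_add_sum_filter_not univ (fun j => f j = u)]
    ring
  have hsplit : ∀ φ : ℝ → ℝ, ∑ k, p k * φ (f k) = P * φ u + (1 - P) * φ v := by
    intro φ
    rw [← Finset.sum_filter_add_sum_filter_not univ (fun j => f j = u), ← hcompl, hP,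
      Finset.sum_mul, Finset.sum_mul]
    congr 1
    · exact Finset.sum_congr rfl fun k hk => by rw [(Finset.mem_filter.mp hk).2]
    · exact Finset.sum_congr rfl fun k hk => by
        rw [(huv k).resolve_left (Finset.mem_filter.mp hk).2]
  have hPα : α ≤ P := (hp b).trans
    (Finset.single_le_sum (f := p) (fun j _ => hnn j) (by simp [hb']))
  have hPα' : α ≤ 1 - P := by
    rw [← hcompl]
    exact (hp a).trans
      (Finset.single_le_sum (f := p) (fun j _ => hnn j) (by simp [ha]))
  have e1 := hsplit (fun y => y)
  have e2 := hsplit (fun y => y ^ 2)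
  have e4 := hsplit (fun y => y ^ 4)
  rw [e1, e2, e4]
  exact two_point_fourth_moment_le hα hPα hPα'

lemma exists_two_values_or_three_distinct {ι : Type*} [Nonempty ι] (f : ι → ℝ) :
    (∃ u v, ∀ j, f j = u ∨ f j = v) ∨ ∃ a b c, f a ≠ f b ∧ f a ≠ f c ∧ f b ≠ f c := by
  by_contra! h
  obtain ⟨h2, h3⟩ := h
  obtain ⟨a⟩ := ‹Nonempty ι›
  obtain ⟨b, hb, -⟩ := h2 (f a) (f a)
  obtain ⟨c, hca, hcb⟩ := h2 (f a) (f b)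
  exact hcb (h3 a b c hb.symm hca.symm).symm

/-- The one-variable `(2,4)`-hypercontractive inequality, on a space all of whose atoms have
probability at least `α`. -/
lemma fourth_moment_le_of_pos {ι : Type*} [Fintype ι] {p : ι → ℝ} {α : ℝ} (hα : 0 < α)
    (hα' : α < 1) (hp : ∀ j, α ≤ p j) (hsum : ∑ j, p j = 1) (f : ι → ℝ) :
    ∑ k, p k * f k ^ 4
      ≤ ((1 + 1 / √(α * (1 - α))) * ∑ k, p k * f k ^ 2
          - (1 / √(α * (1 - α))) * (∑ k, p k * f k) ^ 2) ^ 2 := by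
  have hnn : ∀ j, 0 < p j := fun j => hα.trans_le (hp j)
  by_cases hf0 : f = 0
  · simp [hf0]
  set lam := 1 / √(α * (1 - α)) with hlam
  have hlam2 : lam ^ 2 * (α * (1 - α)) = 1 := by
    have hpos : 0 < α * (1 - α) := mul_pos hα (by linarith)
    rw [hlam, div_pow, Real.sq_sqrt hpos.le, one_pow, one_div_mul_cancel hpos.ne']
  have hlam0 : 0 ≤ lam := by positivity
  let M4 : (ι → ℝ) → ℝ := fun f => ∑ k, p k * f k ^ 4
  let Q : (ι → ℝ) → ℝ := fun f =>
    (1 + lam) * ∑ k, p k * f k ^ 2 - lam * (∑ k, p k * f k) ^ 2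
  have hM4pos : ∀ f : ι → ℝ, f ≠ 0 → 0 < M4 f := by
    intro f hf
    obtain ⟨j, hj⟩ := Function.ne_iff.mp hf
    refine Finset.sum_pos' (fun k _ => ?_) ⟨j, Finset.mem_univ j, ?_⟩
    · have := hnn k
      positivity
    · have := hnn j
      have hj' : f j ≠ 0 := hj
      positivity
  have hM4smul : ∀ (c : ℝ) (f : ι → ℝ), M4 (c • f) = c ^ 4 * M4 f := by
    intro c f
    simp only [M4, Pi.smul_apply, smul_eq_mul, Finset.mul_sum]
    exact Finset.sum_congr rfl fun k _ => by ring
  have hQsmul : ∀ (c : ℝ) (f : ι → ℝ), Q (c • f) = c ^ 2 * Q f := by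
    intro c f
    have h2 : ∑ k, p k * (c * f k) ^ 2 = c ^ 2 * ∑ k, p k * f k ^ 2 := by
      rw [Finset.mul_sum]
      exact Finset.sum_congr rfl fun k _ => by ring
    have h1 : ∑ k, p k * (c * f k) = c * ∑ k, p k * f k := by
      rw [Finset.mul_sum]
      exact Finset.sum_congr rfl fun k _ => by ring
    simp only [Q, Pi.smul_apply, smul_eq_mul, h1, h2]
    ring
  have hnormf : ‖(‖f‖⁻¹ • f)‖ = 1 := norm_smul_inv_norm (𝕜 := ℝ) hf0
  have hne0 : ∀ g ∈ Metric.sphere (0 : ι → ℝ) 1, g ≠ 0 := by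
    intro g hg h0
    simp [h0] at hg
  obtain ⟨f₀, hf₀, hmin⟩ := (isCompact_sphere (0 : ι → ℝ) 1).exists_isMinOn
    ⟨‖f‖⁻¹ • f, by simpa using hnormf⟩
    (f := fun g => Q g ^ 2 / M4 g)
    (ContinuousOn.div (by fun_prop) (by fun_prop) fun g hg => (hM4pos g (hne0 g hg)).ne')
  have hf₀0 := hne0 f₀ hf₀
  set r := Q f₀ ^ 2 / M4 f₀ with hr
  have hrmin : ∀ g : ι → ℝ, r * M4 g ≤ Q g ^ 2 := by
    intro g
    by_cases hg : g = 0
    · simp [hg, M4, Q]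
    have hmem : ‖g‖⁻¹ • g ∈ Metric.sphere (0 : ι → ℝ) 1 := by
      simpa using norm_smul_inv_norm (𝕜 := ℝ) hg
    have h := isMinOn_iff.mp hmin _ hmem
    rw [hM4smul, hQsmul, ← hr] at h
    have hc : (‖g‖⁻¹) ≠ 0 := inv_ne_zero (norm_ne_zero_iff.mpr hg)
    have hM := hM4pos g hg
    have : (‖g‖⁻¹ ^ 2 * Q g) ^ 2 / (‖g‖⁻¹ ^ 4 * M4 g) = Q g ^ 2 / M4 g := by
      rw [mul_pow, ← pow_mul]
      exact mul_div_mul_left _ _ (pow_ne_zero _ hc)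
    rw [this, le_div_iff₀ hM] at h
    exact h
  have hreq : r * M4 f₀ = Q f₀ ^ 2 := by
    rw [hr, div_mul_cancel₀ _ (hM4pos f₀ hf₀0).ne']
  suffices h1 : 1 ≤ r by
    have hM : 0 ≤ M4 f := (hM4pos f hf0).le
    exact (le_mul_of_one_le_left hM h1).trans (hrmin f)
  have : Nonempty ι := (Function.ne_iff.mp hf0).nonempty
  rcases exists_two_values_or_three_distinct f₀ with ⟨u, v, huv⟩ | ⟨a, b, c, hab, hac, hbc⟩
  · rw [hr, one_le_div (hM4pos f₀ hf₀0)]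
    exact fourth_moment_le_of_two_values hα hp hsum huv
  · have hEL := euler_lagrange (C := 1 + lam) (r := r) hnn
      (by simpa [M4, Q] using hrmin) (f := f₀) (by simpa [M4, Q] using hreq)
    have hEL' : ∀ j, Q f₀ * ((1 + lam) * f₀ j - lam * ∑ k, p k * f₀ k) = r * f₀ j ^ 3 := by
      simpa [Q] using hEL
    have hA := hEL' a
    have hB := hEL' b
    have hC := hEL' c
    have hM := hM4pos f₀ hf₀0
    have hMge : α * (f₀ a ^ 4 + f₀ b ^ 4 + f₀ c ^ 4) ≤ M4 f₀ := by
      have hab' : a ≠ b := fun h => hab (by rw [h])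
      have hac' : a ≠ c := fun h => hac (by rw [h])
      have hbc' : b ≠ c := fun h => hbc (by rw [h])
      have hle : ∑ k ∈ ({a, b, c} : Finset ι), p k * f₀ k ^ 4 ≤ M4 f₀ :=
        Finset.sum_le_univ_sum_of_nonneg fun k => by
          have := hnn k
          positivity
      rw [Finset.sum_insert (by simp [hab', hac']), Finset.sum_insert (by simp [hbc']),
        Finset.sum_singleton] at hle
      have ha := mul_le_mul_of_nonneg_right (hp a) (by positivity : 0 ≤ f₀ a ^ 4)
      have hb := mul_le_mul_of_nonneg_right (hp b) (by positivity : 0 ≤ f₀ b ^ 4)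
      have hc := mul_le_mul_of_nonneg_right (hp c) (by positivity : 0 ≤ f₀ c ^ 4)
      linarith
    set x := f₀ a
    set y := f₀ b
    set z := f₀ c
    set q := Q f₀
    have hxy : r * (x ^ 2 + x * y + y ^ 2) = q * (1 + lam) := by
      refine mul_left_cancel₀ (sub_ne_zero.mpr hab) ?_
      linear_combination hB - hA
    have hxz : r * (x ^ 2 + x * z + z ^ 2) = q * (1 + lam) := by
      refine mul_left_cancel₀ (sub_ne_zero.mpr hac) ?_
      linear_combination hC - hA
    have hr0 : 0 < r := by
      have hvar : (∑ k, p k * f₀ k) ^ 2 ≤ ∑ k, p k * f₀ k ^ 2 := by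
        have h := Finset.sum_sq_le_sum_mul_sum_of_sq_le_mul univ (r := fun k => p k * f₀ k)
          (f := p) (g := fun k => p k * f₀ k ^ 2) (fun k _ => (hnn k).le)
          (fun k _ => mul_nonneg (hnn k).le (sq_nonneg _)) (fun k _ => le_of_eq (by ring))
        rwa [hsum, one_mul] at h
      have hm2 : 0 < ∑ k, p k * f₀ k ^ 2 := by
        obtain ⟨j, hj⟩ := Function.ne_iff.mp hf₀0
        have hj' : f₀ j ≠ 0 := hj
        refine Finset.sum_pos' (fun k _ => mul_nonneg (hnn k).le (sq_nonneg _))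
          ⟨j, Finset.mem_univ j, mul_pos (hnn j) (by positivity)⟩
      have hq0 : 0 < q := by
        have : q = (1 + lam) * ∑ k, p k * f₀ k ^ 2 - lam * (∑ k, p k * f₀ k) ^ 2 := rfl
        nlinarith
      rw [hr]
      positivity
    have hsum0 : x + y + z = 0 := by
      have : r * (y - z) * (x + y + z) = 0 := by linear_combination hxy - hxz
      exact (mul_eq_zero.mp this).resolve_left
        (mul_ne_zero hr0.ne' (sub_ne_zero.mpr hbc))
    have hz : z = -x - y := by linarith
    have hquart : x ^ 4 + y ^ 4 + z ^ 4 = 2 * (x ^ 2 + x * y + y ^ 2) ^ 2 := by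
      rw [hz]; ring
    rw [hquart] at hMge
    set w := x ^ 2 + x * y + y ^ 2
    have hw : r * w ^ 2 = M4 f₀ * (1 + lam) ^ 2 := by
      refine mul_left_cancel₀ hr0.ne' ?_
      linear_combination (r * w + q * (1 + lam)) * hxy - (1 + lam) ^ 2 * hreq
    have hαlam : 1 ≤ 2 * α * (1 + lam) ^ 2 := by
      have h1 : 0 ≤ (α * lam) ^ 2 := sq_nonneg _
      have h2 : 0 ≤ α * lam := mul_nonneg hα.le hlam0
      have h3 : α * lam ^ 2 = 1 + (α * lam) ^ 2 := by linear_combination hlam2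
      have h4 : 2 * α * (1 + lam) ^ 2 = 2 * α + 4 * (α * lam) + 2 * (α * lam ^ 2) := by ring
      rw [h4, h3]
      linarith
    have hle : (2 * α * (1 + lam) ^ 2) * M4 f₀ ≤ r * M4 f₀ := by
      have h1 : (2 * α * (1 + lam) ^ 2) * M4 f₀ = r * (α * (2 * w ^ 2)) := by
        linear_combination (-2 * α) * hw
      rw [h1]
      exact mul_le_mul_of_nonneg_left hMge hr0.le
    exact hαlam.trans (le_of_mul_le_mul_right hle hM)

lemma sum_mul_eq_sum_support {A : Type*} [Fintype A] {μ : A → ℝ} (hμ : ∀ a, 0 ≤ μ a)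
    (φ : A → ℝ) : ∑ a, μ a * φ a = ∑ a : {a // 0 < μ a}, μ a * φ a := by
  rw [← Finset.sum_subtype (univ.filter fun a => 0 < μ a) (by simp) (fun a => μ a * φ a)]
  refine (Finset.sum_filter_of_ne fun a _ h => ?_).symm
  exact lt_of_le_of_ne (hμ a) (Ne.symm (left_ne_zero_of_mul h))

lemma minAtom_le {A : Type*} [Fintype A] {μ : A → ℝ} {a : A} (ha : 0 < μ a) :
    minAtom μ ≤ μ a :=
  csInf_le ⟨0, fun _ ⟨_, _, hx⟩ => hx.le⟩ ⟨a, rfl, ha⟩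

lemma minAtom_pos {A : Type*} [Fintype A] {μ : A → ℝ} (hμ : IsDist μ) : 0 < minAtom μ := by
  have hne : { x | ∃ a, μ a = x ∧ 0 < x }.Nonempty := by
    obtain ⟨a, -, ha⟩ := Finset.exists_lt_of_sum_lt (s := univ) (f := fun _ : A => (0 : ℝ))
      (g := μ) (by simp [hμ.2])
    exact ⟨μ a, a, rfl, ha⟩
  have hfin : { x | ∃ a, μ a = x ∧ 0 < x }.Finite :=
    (Set.finite_range μ).subset fun x ⟨a, ha, _⟩ => ⟨a, ha⟩
  obtain ⟨a, -, h⟩ := hne.csInf_mem hfin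
  exact h

lemma C4_eq {α : ℝ} (h0 : 0 < α) (h1 : α ≤ 1 / 2) : C4 α = 1 + 1 / √(α * (1 - α)) := by
  have hpos : 0 < α * (1 - α) := mul_pos h0 (by linarith)
  have hs : 0 < √(α * (1 - α)) := Real.sqrt_pos.mpr hpos
  have hs2 : √(α * (1 - α)) ^ 2 = α * (1 - α) := Real.sq_sqrt hpos.le
  unfold C4
  split_ifs with h
  · have : √(α * (1 - α)) = 1 / 2 := by
      rw [h, Real.sqrt_eq_iff_mul_self_eq_of_pos (by norm_num)]
      norm_num
    rw [this]
    norm_num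
  · have hlt : α < 1 / 2 := lt_of_le_of_ne h1 h
    set s := √(α * (1 - α))
    set X := (1 - α) / α with hX
    have hX1 : 1 < X := by
      rw [hX, one_lt_div h0]
      linarith
    have hX0 : 0 < X := by linarith
    set b := X ^ ((1 : ℝ) / 4) with hb
    have hb1 : 1 < b := Real.one_lt_rpow hX1 (by norm_num)
    have hb0 : 0 < b := by linarith
    have hb4 : b ^ 4 = X := by
      rw [hb, ← Real.rpow_natCast, ← Real.rpow_mul hX0.le]
      norm_num
    have hb3 : X ^ ((3 : ℝ) / 4) = b ^ 3 := by
      rw [hb, ← Real.rpow_natCast, ← Real.rpow_mul hX0.le]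
      norm_num
    rw [Real.rpow_neg hX0.le, Real.rpow_neg hX0.le, hb3, ← hb]
    have hb2 : b ^ 2 = (1 - α) / s := by
      rw [← sq_eq_sq₀ (by positivity) (div_nonneg (by linarith) hs.le), div_pow, hs2, ← pow_mul,
        hb4, hX]
      have : 1 - α ≠ 0 := by linarith
      field_simp
    have hbinv : (b ^ 2)⁻¹ = α / s := by
      rw [hb2, inv_div, div_eq_div_iff (by linarith) hs.ne']
      linear_combination hs2
    have hne : b - b⁻¹ ≠ 0 := by
      have : b⁻¹ < 1 := inv_lt_one_of_one_lt₀ hb1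
      linarith
    have hquot : (b ^ 3 - (b ^ 3)⁻¹) / (b - b⁻¹) = 1 + (b ^ 2 + (b ^ 2)⁻¹) := by
      rw [div_eq_iff hne]
      field_simp
      ring
    rw [hquot, hbinv, hb2]
    ring

lemma one_le_C4 {α : ℝ} (h0 : 0 < α) (h1 : α ≤ 1 / 2) : 1 ≤ C4 α := by
  rw [C4_eq h0 h1]
  exact le_add_of_nonneg_right (by positivity)

/-- The one-variable `(2,4)`-hypercontractive inequality. -/
lemma fourth_moment_le {A : Type*} [Fintype A] {μ : A → ℝ} (hμ : IsDist μ)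
    (hα : minAtom μ ≤ 1 / 2) (f : A → ℝ) :
    ∑ a, μ a * f a ^ 4
      ≤ (C4 (minAtom μ) * ∑ a, μ a * f a ^ 2
          - (C4 (minAtom μ) - 1) * (∑ a, μ a * f a) ^ 2) ^ 2 := by
  have h0 := minAtom_pos hμ
  rw [C4_eq h0 hα, add_sub_cancel_left, sum_mul_eq_sum_support hμ.1,
    sum_mul_eq_sum_support hμ.1, sum_mul_eq_sum_support hμ.1]
  refine fourth_moment_le_of_pos (p := fun a : {a // 0 < μ a} => μ a) h0 (by linarith)
    (fun a => minAtom_le a.2) ?_ (fun a => f a)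
  have h := sum_mul_eq_sum_support hμ.1 (fun _ => 1)
  simp only [mul_one] at h
  rw [← h, hμ.2]

/-! ### Expectations -/

section pmean

variable {Ω κ : Type*} [Fintype Ω] [Fintype κ] {p : Ω → ℝ}

lemma pmean_mono (hp : ∀ ω, 0 ≤ p ω) {F G : Ω → ℝ} (h : ∀ ω, F ω ≤ G ω) :
    pmean p F ≤ pmean p G :=
  Finset.sum_le_sum fun ω _ => mul_le_mul_of_nonneg_left (h ω) (hp ω)

lemma pmean_nonneg (hp : ∀ ω, 0 ≤ p ω) {F : Ω → ℝ} (h : ∀ ω, 0 ≤ F ω) : 0 ≤ pmean p F :=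
  Finset.sum_nonneg fun ω _ => mul_nonneg (hp ω) (h ω)

lemma pmean_sum (F : κ → Ω → ℝ) :
    pmean p (fun ω => ∑ k, F k ω) = ∑ k, pmean p (F k) := by
  simp only [pmean, Finset.mul_sum]
  exact Finset.sum_comm

lemma pmean_const_mul (c : ℝ) (F : Ω → ℝ) : pmean p (fun ω => c * F ω) = c * pmean p F := by
  simp only [pmean, Finset.mul_sum]
  exact Finset.sum_congr rfl fun ω _ => by ring

lemma pmean_add (F G : Ω → ℝ) :
    pmean p (fun ω => F ω + G ω) = pmean p F + pmean p G := by
  simp only [pmean, mul_add, Finset.sum_add_distrib]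

lemma pmean_mul_le (hp : ∀ ω, 0 ≤ p ω) {F G : Ω → ℝ} {a b : ℝ} (ha : 0 ≤ a) (hb : 0 ≤ b)
    (hF : pmean p (fun ω => F ω ^ 2) ≤ a ^ 2) (hG : pmean p (fun ω => G ω ^ 2) ≤ b ^ 2) :
    pmean p (fun ω => F ω * G ω) ≤ a * b := by
  have h := Finset.sum_sq_le_sum_mul_sum_of_sq_le_mul univ (r := fun ω => p ω * (F ω * G ω))
    (f := fun ω => p ω * F ω ^ 2) (g := fun ω => p ω * G ω ^ 2)
    (fun ω _ => mul_nonneg (hp ω) (sq_nonneg _)) (fun ω _ => mul_nonneg (hp ω) (sq_nonneg _))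
    (fun ω _ => le_of_eq (by ring))
  refine (le_abs_self _).trans (abs_le_of_sq_le_sq ?_ (mul_nonneg ha hb))
  rw [mul_pow]
  exact h.trans (mul_le_mul hF hG (pmean_nonneg hp fun ω => sq_nonneg _) (sq_nonneg a))

/-- Minkowski's inequality in `L²`. -/
lemma pmean_sum_sq_le (hp : ∀ ω, 0 ≤ p ω) {G : κ → Ω → ℝ} {c : κ → ℝ} (hc : ∀ k, 0 ≤ c k)
    (hG : ∀ k, pmean p (fun ω => G k ω ^ 2) ≤ c k ^ 2) :
    pmean p (fun ω => (∑ k, G k ω) ^ 2) ≤ (∑ k, c k) ^ 2 := by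
  simp only [sq (∑ k, _), Finset.sum_mul_sum, pmean_sum]
  exact Finset.sum_le_sum fun k _ => Finset.sum_le_sum fun l _ =>
    pmean_mul_le hp (hc k) (hc l) (hG k) (hG l)

end pmean

section product

variable {A : Type*} [Fintype A] {μ : A → ℝ}

lemma prodDist_nonneg (hμ : ∀ a, 0 ≤ μ a) {n : ℕ} (x : Fin n → A) : 0 ≤ prodDist μ n x :=
  Finset.prod_nonneg fun i _ => hμ (x i)

lemma pmean_prodDist_zero (f : (Fin 0 → A) → ℝ) (x : Fin 0 → A) :
    pmean (prodDist μ 0) f = f x := by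
  simp [pmean, prodDist, Subsingleton.elim x default]

lemma pmean_prodDist_succ {n : ℕ} (f : (Fin (n + 1) → A) → ℝ) :
    pmean (prodDist μ (n + 1)) f
      = ∑ y, μ y * pmean (prodDist μ n) (fun x => f (Fin.cons y x)) := by
  simp only [pmean, prodDist, Finset.mul_sum]
  rw [← (Fin.consEquiv fun _ : Fin (n + 1) => A).sum_comp, Fintype.sum_prod_type]
  refine Finset.sum_congr rfl fun y _ => Finset.sum_congr rfl fun x _ => ?_
  simp [Fin.consEquiv, Fin.prod_univ_succ, mul_assoc]

lemma pmean_prodDist_const (hμ : ∑ a, μ a = 1) (n : ℕ) (c : ℝ) :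
    pmean (prodDist μ n) (fun _ => c) = c := by
  induction n with
  | zero => simp [pmean, prodDist]
  | succ n ih => rw [pmean_prodDist_succ, ih, ← Finset.sum_mul, hμ, one_mul]

/-- Resampling: if `ξ` and `x` are independent, the mixture of `ξ` on `H` and `x` off `H` has
the same distribution as `x`. -/
lemma pmean_pmean_merge (hμ : ∑ a, μ a = 1) {n : ℕ} (H : Finset (Fin n))
    (φ : (Fin n → A) → ℝ) :
    pmean (prodDist μ n)
        (fun ξ => pmean (prodDist μ n) (fun x => φ (fun j => if j ∈ H then ξ j else x j)))
      = pmean (prodDist μ n) φ := by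
  let σ : (Fin n → A) × (Fin n → A) → (Fin n → A) × (Fin n → A) := fun q =>
    (fun j => if j ∈ H then q.1 j else q.2 j, fun j => if j ∈ H then q.2 j else q.1 j)
  have hσ : Function.Involutive σ := by
    intro q
    ext j <;> by_cases hj : j ∈ H <;> simp [σ, hj]
  have hw : ∀ q, prodDist μ n (σ q).1 * prodDist μ n (σ q).2
      = prodDist μ n q.1 * prodDist μ n q.2 := by
    intro q
    simp only [prodDist, ← Finset.prod_mul_distrib]
    refine Finset.prod_congr rfl fun j _ => ?_
    by_cases hj : j ∈ H <;> simp [σ, hj, mul_comm]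
  have h1 : ∀ ψ : (Fin n → A) × (Fin n → A) → ℝ,
      pmean (prodDist μ n) (fun ξ => pmean (prodDist μ n) (fun x => ψ (ξ, x)))
        = ∑ q : (Fin n → A) × (Fin n → A), prodDist μ n q.1 * prodDist μ n q.2 * ψ q := by
    intro ψ
    simp only [pmean, Finset.mul_sum, Fintype.sum_prod_type, mul_assoc]
  calc _ = ∑ q : (Fin n → A) × (Fin n → A),
            prodDist μ n q.1 * prodDist μ n q.2 * φ (σ q).1 := h1 fun q => φ (σ q).1
    _ = ∑ q : (Fin n → A) × (Fin n → A), prodDist μ n q.1 * prodDist μ n q.2 * φ q.1 := by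
        rw [← hσ.bijective.sum_comp fun q => prodDist μ n q.1 * prodDist μ n q.2 * φ q.1]
        exact Finset.sum_congr rfl fun q _ => by rw [hw]
    _ = _ := by
        rw [← h1 fun q => φ q.1]
        simp only [pmean_prodDist_const hμ]

end product

/-! ### Degree -/

section degree

variable {A : Type*}

lemma degLE.map {n m d e : ℕ} (L : ((Fin n → A) → ℝ) →ₗ[ℝ] ((Fin m → A) → ℝ))
    (hL : ∀ g, DependsOnLE d g → degLE e (L g)) {f : (Fin n → A) → ℝ} (hf : degLE d f) :
    degLE e (L f) :=
  (Submodule.span_le (p := (Submodule.span ℝ { g | DependsOnLE e g }).comap L)).mpr hL hf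

lemma degLE_zero_const {n : ℕ} {f : (Fin n → A) → ℝ} (hf : degLE 0 f) (x y : Fin n → A) :
    f x = f y := by
  refine Submodule.span_induction (p := fun f _ => f x = f y) ?_ rfl ?_ ?_ hf
  · rintro g ⟨J, hJ, hg⟩
    refine hg x y fun i hi => ?_
    simp [Finset.card_eq_zero.mp (Nat.le_zero.mp hJ)] at hi
  · intro g h _ _ hg hh
    simp [hg, hh]
  · intro c g _ hg
    simp [hg]

lemma DependsOnLE.comp_cons {n d : ℕ} {g : (Fin (n + 1) → A) → ℝ} (hg : DependsOnLE d g)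
    (y : A) : DependsOnLE d (fun x => g (Fin.cons y x)) := by
  obtain ⟨J, hJ, h⟩ := hg
  refine ⟨J.preimage Fin.succ (Fin.succ_injective n).injOn,
    (Finset.card_le_card_of_injOn Fin.succ (by intro i hi; simpa using hi)
      (Fin.succ_injective n).injOn).trans hJ, fun x x' hx => h _ _ fun i hi => ?_⟩
  refine Fin.cases (fun _ => rfl) (fun j hj => ?_) i hi
  simpa using hx j (by simpa using hj)

lemma DependsOnLE.comp_cons_sub {n d : ℕ} {g : (Fin (n + 1) → A) → ℝ}
    (hg : DependsOnLE (d + 1) g) (y z : A) :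
    DependsOnLE d (fun x => g (Fin.cons y x) - g (Fin.cons z x)) := by
  obtain ⟨J, hJ, h⟩ := hg
  by_cases h0 : (0 : Fin (n + 1)) ∈ J
  · refine ⟨J.preimage Fin.succ (Fin.succ_injective n).injOn, ?_, fun x x' hx => ?_⟩
    · have hle : (J.preimage Fin.succ (Fin.succ_injective n).injOn).card ≤ (J.erase 0).card :=
        Finset.card_le_card_of_injOn Fin.succ
          (by intro i hi; simpa [Fin.succ_ne_zero] using hi) (Fin.succ_injective n).injOn
      rw [Finset.card_erase_of_mem h0] at hle
      omega
    · have key : ∀ w : A, g (Fin.cons w x) = g (Fin.cons w x') := fun w => by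
        refine h _ _ fun i hi => ?_
        refine Fin.cases (fun _ => rfl) (fun j hj => ?_) i hi
        simpa using hx j (by simpa using hj)
      simp only [key]
  · refine ⟨∅, by simp, fun x x' _ => ?_⟩
    have key : ∀ u : Fin n → A, g (Fin.cons y u) = g (Fin.cons z u) := fun u => by
      refine h _ _ fun i hi => ?_
      refine Fin.cases (fun h' => absurd h' h0) (fun j _ => by simp) i hi
    simp [key]

lemma degLE.comp_cons {n d : ℕ} {f : (Fin (n + 1) → A) → ℝ} (hf : degLE d f) (y : A) :
    degLE d (fun x => f (Fin.cons y x)) :=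
  hf.map (LinearMap.funLeft ℝ ℝ (fun x : Fin n → A => (Fin.cons y x : Fin (n + 1) → A)))
    fun _ hg => Submodule.subset_span (hg.comp_cons y)

lemma degLE.comp_cons_sub {n d : ℕ} {f : (Fin (n + 1) → A) → ℝ} (hf : degLE (d + 1) f)
    (y z : A) : degLE d (fun x => f (Fin.cons y x) - f (Fin.cons z x)) :=
  hf.map (LinearMap.funLeft ℝ ℝ (fun x : Fin n → A => (Fin.cons y x : Fin (n + 1) → A))
      - LinearMap.funLeft ℝ ℝ (fun x : Fin n → A => (Fin.cons z x : Fin (n + 1) → A)))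
    fun _ hg => Submodule.subset_span (hg.comp_cons_sub y z)

lemma degLE.sum_mul [Fintype A] {n d : ℕ} {F : A → (Fin n → A) → ℝ} (hF : ∀ z, degLE d (F z))
    (w : A → ℝ) : degLE d (fun x => ∑ z, w z * F z x) := by
  have h : (fun x => ∑ z, w z * F z x) = ∑ z, w z • F z := by
    ext x
    simp
  rw [h]
  exact Submodule.sum_mem _ fun z _ => Submodule.smul_mem _ _ (hF z)

/-- Fixing the coordinates off `H` does not increase the degree. -/
lemma degLE.comp_merge {n d : ℕ} {f : (Fin n → A) → ℝ} (hf : degLE d f) (H : Finset (Fin n))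
    (x : Fin n → A) : degLE d (fun ξ => f (fun j => if j ∈ H then ξ j else x j)) :=
  hf.map (LinearMap.funLeft ℝ ℝ (fun ξ : Fin n → A => fun j => if j ∈ H then ξ j else x j))
    fun _ ⟨J, hJ, hg⟩ => Submodule.subset_span
      ⟨J, hJ, fun ξ ξ' h => hg _ _ fun i hi => by simp only [h i hi]⟩

end degree

/-! ### Hypercontractivity for low-degree functions -/

/-- A one-variable `(2,4)`-hypercontractive inequality tensorizes to functions of degree at most
`d`. -/
theorem pmean_pow_four_le {A : Type*} [Fintype A] {μ : A → ℝ} (hμ : IsDist μ) {C : ℝ}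
    (hC1 : 1 ≤ C)
    (hC : ∀ f : A → ℝ, ∑ a, μ a * f a ^ 4
      ≤ (C * ∑ a, μ a * f a ^ 2 - (C - 1) * (∑ a, μ a * f a) ^ 2) ^ 2)
    {n d : ℕ} {f : (Fin n → A) → ℝ} (hf : degLE d f) :
    pmean (prodDist μ n) (fun x => f x ^ 4)
      ≤ (C ^ d * pmean (prodDist μ n) (fun x => f x ^ 2)) ^ 2 := by
  have hC0 : 0 ≤ C := by linarith
  induction n generalizing d with
  | zero =>
    rw [pmean_prodDist_zero _ default, pmean_prodDist_zero _ default, mul_pow, ← pow_mul,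
      ← pow_mul]
    exact le_mul_of_one_le_left (by positivity) (one_le_pow₀ hC1)
  | succ n ih =>
    have hE0 := fun x => prodDist_nonneg hμ.1 (n := n) x
    cases d with
    | zero =>
      have : Nonempty A := by
        by_contra h
        rw [not_nonempty_iff] at h
        simpa using hμ.2
      obtain ⟨a⟩ := this
      have hconst : ∀ x, f x = f fun _ => a := fun x => degLE_zero_const hf x _
      simp only [hconst, pmean_prodDist_const hμ.2]
      apply le_of_eq
      ring
    | succ d =>
      set g : (Fin n → A) → ℝ := fun x => ∑ z, μ z * f (Fin.cons z x) with hg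
      set h : A → (Fin n → A) → ℝ := fun y x => f (Fin.cons y x) - g x with hh
      have hgdeg : degLE (d + 1) g := degLE.sum_mul (fun z => hf.comp_cons z) μ
      have hhdeg : ∀ y, degLE d (h y) := by
        intro y
        have : h y = fun x => ∑ z, μ z * (f (Fin.cons y x) - f (Fin.cons z x)) := by
          ext x
          simp only [hh, hg, mul_sub, Finset.sum_sub_distrib, ← Finset.sum_mul, hμ.2, one_mul]
        rw [this]
        exact degLE.sum_mul (fun z => hf.comp_cons_sub y z) μ
      have hvar : ∀ x, ∑ y, μ y * h y x ^ 2 = ∑ y, μ y * f (Fin.cons y x) ^ 2 - g x ^ 2 := by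
        intro x
        have e : ∀ y, μ y * h y x ^ 2 = μ y * f (Fin.cons y x) ^ 2
            - 2 * g x * (μ y * f (Fin.cons y x)) + μ y * g x ^ 2 := fun y => by
          simp only [hh]
          ring
        have hgx : ∑ y, μ y * f (Fin.cons y x) = g x := rfl
        simp only [e, Finset.sum_add_distrib, Finset.sum_sub_distrib, ← Finset.mul_sum,
          ← Finset.sum_mul, hμ.2, hgx]
        ring
      let G : Option A → (Fin n → A) → ℝ := fun k x =>
        k.elim (g x ^ 2) fun y => C * μ y * h y x ^ 2
      let c : Option A → ℝ := fun k =>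
        k.elim (C ^ (d + 1) * pmean (prodDist μ n) fun x => g x ^ 2)
          fun y => C * μ y * (C ^ d * pmean (prodDist μ n) fun x => h y x ^ 2)
      have hsq : ∀ u : (Fin n → A) → ℝ, 0 ≤ pmean (prodDist μ n) fun x => u x ^ 2 :=
        fun u => pmean_nonneg hE0 fun x => sq_nonneg _
      have hc : ∀ k, 0 ≤ c k := by
        rintro (_ | y)
        · exact mul_nonneg (pow_nonneg hC0 _) (hsq g)
        · exact mul_nonneg (mul_nonneg hC0 (hμ.1 y))
            (mul_nonneg (pow_nonneg hC0 _) (hsq (h y)))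
      have hG : ∀ k, pmean (prodDist μ n) (fun x => G k x ^ 2) ≤ c k ^ 2 := by
        rintro (_ | y)
        · simpa only [G, c, Option.elim, ← pow_mul] using ih hgdeg
        · simp only [G, c, Option.elim, mul_pow _ _ 2, pmean_const_mul, ← pow_mul]
          have := ih (hhdeg y)
          rw [mul_pow, ← pow_mul] at this
          exact mul_le_mul_of_nonneg_left this (by positivity)
      have hGsum : ∀ x, ∑ k, G k x = g x ^ 2 + C * ∑ y, μ y * h y x ^ 2 := by
        intro x
        simp only [Fintype.sum_option, G, Option.elim, Finset.mul_sum, mul_assoc]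
      have hcsum : ∑ k, c k
          = C ^ (d + 1) * pmean (prodDist μ (n + 1)) (fun x => f x ^ 2) := by
        have e : pmean (prodDist μ (n + 1)) (fun x => f x ^ 2)
            = pmean (prodDist μ n) (fun x => g x ^ 2)
              + ∑ y, μ y * pmean (prodDist μ n) (fun x => h y x ^ 2) := by
          rw [pmean_prodDist_succ]
          simp only [← pmean_const_mul, ← pmean_sum, ← pmean_add, hvar, add_sub_cancel]
        rw [e, mul_add, Finset.mul_sum]
        simp only [Fintype.sum_option, c, Option.elim]
        congr 1
        exact Finset.sum_congr rfl fun y _ => by ring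
      rw [← hcsum, pmean_prodDist_succ]
      simp only [← pmean_const_mul, ← pmean_sum]
      refine le_trans (pmean_mono hE0 fun x => ?_) (pmean_sum_sq_le hE0 hc hG)
      rw [hGsum, hvar]
      refine (hC fun y => f (Fin.cons y x)).trans (le_of_eq ?_)
      have hgx : ∑ y, μ y * f (Fin.cons y x) = g x := rfl
      rw [hgx]
      ring

lemma influence_eq_pmean {A : Type*} [Fintype A] {n : ℕ} (μ : A → ℝ) (i : Fin n)
    (f : (Fin n → A) → ℝ) :
    influence μ i f = (1 / 2) * pmean (prodDist μ n)
      (fun x => ∑ a, μ a * (f x - f (Function.update x i a)) ^ 2) := by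
  simp only [influence, pmean, prodDist, Finset.mul_sum, mul_assoc]

/-- L²-norm bound on the restricted influence (Equation (1) in the proof of
Claim 5.4): `‖ξ ↦ Inf_i(P_ξ)‖₂ ≤ C₄(α)^d · Inf_i(P)`. -/
theorem stmt7 {A : Type*} [Fintype A] (μA : A → ℝ) (hμA : IsDist μA)
    (hα : minAtom μA ≤ 1 / 2) {n : ℕ} (d : ℕ) (P : (Fin n → A) → ℝ) (hP : degLE d P)
    (H : Finset (Fin n)) (i : Fin n) (hi : i ∉ H) :
    Real.sqrt (pmean (prodDist μA n) (fun ξ => (influence μA i (restrictFn H ξ P)) ^ 2))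
      ≤ C4 (minAtom μA) ^ d * influence μA i P := by
  have hC1 := one_le_C4 (minAtom_pos hμA) hα
  have hC := fourth_moment_le hμA hα
  set C := C4 (minAtom μA)
  have hC0 : 0 ≤ C := by linarith
  have hE0 := fun x => prodDist_nonneg hμA.1 (n := n) x
  set D : (Fin n → A) × A → (Fin n → A) → ℝ := fun k ξ =>
    restrictFn H ξ P k.1 - restrictFn H ξ P (Function.update k.1 i k.2) with hD
  set w : (Fin n → A) × A → ℝ := fun k => 1 / 2 * (prodDist μA n k.1 * μA k.2) with hw
  have hw0 : ∀ k, 0 ≤ w k := fun k =>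
    mul_nonneg (by norm_num) (mul_nonneg (hE0 k.1) (hμA.1 k.2))
  have hDdeg : ∀ k, degLE d (D k) := fun k =>
    Submodule.sub_mem _ (hP.comp_merge H k.1) (hP.comp_merge H (Function.update k.1 i k.2))
  have hinf : ∀ ξ, influence μA i (restrictFn H ξ P) = ∑ k, w k * D k ξ ^ 2 := by
    intro ξ
    simp only [influence, Finset.mul_sum, Fintype.sum_prod_type, hw, hD, mul_assoc, prodDist]
  have hmerge : ∀ ξ x a, D (x, a) ξ = P (fun j => if j ∈ H then ξ j else x j)
      - P (Function.update (fun j => if j ∈ H then ξ j else x j) i a) := by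
    intro ξ x a
    simp only [hD, restrictFn]
    congr 2
    ext j
    by_cases hj : j = i
    · subst hj
      simp [hi]
    · simp [Function.update_of_ne hj]
  set c : (Fin n → A) × A → ℝ := fun k =>
    w k * (C ^ d * pmean (prodDist μA n) fun ξ => D k ξ ^ 2) with hc
  have hc0 : ∀ k, 0 ≤ c k := fun k => mul_nonneg (hw0 k)
    (mul_nonneg (pow_nonneg hC0 _) (pmean_nonneg hE0 fun ξ => sq_nonneg _))
  have hcsum : ∑ k, c k = C ^ d * influence μA i P := by
    have e : ∑ k, w k * pmean (prodDist μA n) (fun ξ => D k ξ ^ 2) = influence μA i P := by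
      simp only [← pmean_const_mul, ← pmean_sum, ← hinf]
      rw [influence_eq_pmean μA i P, ← pmean_pmean_merge hμA.2 H
        (fun x => ∑ a, μA a * (P x - P (Function.update x i a)) ^ 2), ← pmean_const_mul]
      congr 1
      ext ξ
      rw [influence_eq_pmean]
      congr 2
      ext x
      exact Finset.sum_congr rfl fun a _ => by rw [← hmerge ξ x a]
    rw [← e, Finset.mul_sum]
    exact Finset.sum_congr rfl fun k _ => by ring
  rw [← hcsum]
  refine Real.sqrt_le_iff.mpr ⟨Finset.sum_nonneg fun k _ => hc0 k, ?_⟩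
  simp only [hinf]
  refine pmean_sum_sq_le hE0 hc0 fun k => ?_
  simp only [mul_pow _ _ 2, pmean_const_mul, ← pow_mul, hc]
  have := pmean_pow_four_le hμA hC1 hC (hDdeg k)
  rw [mul_pow, ← pow_mul] at this
  exact mul_le_mul_of_nonneg_left this (sq_nonneg _)

end NIS
end
end

section
/- Let (𝒜×ℬ, μ) be a finite joint probability space with maximal correlation ρ = ρ(𝒜,ℬ;μ) < 1, and let ζ > 0. Then there exists w = w(μ, ζ) ∈ ℕ such that the following holds for all h. Let f₂ : 𝒜^h × ℝ → [−1,1] and g₂ : ℬ^h × ℝ → [−1,1] have threshold form: there exist f₂' : 𝒜^h → ℝ and g₂' : ℬ^h → ℝ with f₂(x,r) = 1 if r ≥ f₂'(x) and −1 otherwise, and g₂(y,r) = 1 if r ≥ g₂'(y) and −1 otherwise. Then there exist f₃ : 𝒜^{h+w} → [−1,1] and g₃ : ℬ^{h+w} → [−1,1] such that |E_{μ_A^{⊗(h+w)}}[f₃] − E_{x∼μ_A^{⊗h}, r_A∼N(0,1)}[f₂(x,r_A)]| ≤ ζ, |E_{μ_B^{⊗(h+w)}}[g₃] − E_{y∼μ_B^{⊗h},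 r_B∼N(0,1)}[g₂(y,r_B)]| ≤ ζ, and |E_{(x,y)∼μ^{⊗(h+w)}}[f₃(x)g₃(y)] − E_{(x,y)∼μ^{⊗h}, (r_A,r_B)∼G(ρ)}[f₂(x,r_A)g₂(y,r_B)]| ≤ ζ. -/
open Finset MeasureTheory ProbabilityTheory Filter
open scoped Classical

noncomputable section

namespace NIS

section LevyPlane

open Topology

lemma charFun_map_toLp (ν : Measure (ℝ × ℝ)) (t : WithLp 2 (ℝ × ℝ)) :
    charFun (ν.map (WithLp.toLp 2)) t =
      ∫ q : ℝ × ℝ, Complex.exp (((t.fst * q.1 + t.snd * q.2 : ℝ) : ℂ) * Complex.I) ∂ν := by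
  rw [charFun_apply, ← MeasurableEquiv.coe_toLp, integral_map_equiv]
  simp [WithLp.prod_inner_apply]

/-- Lévy's continuity theorem in the plane, evaluated on a continuity set of the limit. -/
lemma tendsto_measureReal_of_tendsto_charFun {ν : ℕ → Measure (ℝ × ℝ)} {ν₀ : Measure (ℝ × ℝ)}
    [hν : ∀ n, IsProbabilityMeasure (ν n)] [hν₀ : IsProbabilityMeasure ν₀]
    (h : ∀ t₁ t₂ : ℝ, Tendsto
      (fun n => ∫ q : ℝ × ℝ, Complex.exp (((t₁ * q.1 + t₂ * q.2 : ℝ) : ℂ) * Complex.I) ∂(ν n))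
      atTop (𝓝 (∫ q : ℝ × ℝ, Complex.exp (((t₁ * q.1 + t₂ * q.2 : ℝ) : ℂ) * Complex.I) ∂ν₀)))
    {E : Set (ℝ × ℝ)} (hE : ν₀ (frontier E) = 0) :
    Tendsto (fun n => (ν n).real E) atTop (𝓝 (ν₀.real E)) := by
  have hm : Measurable (WithLp.toLp 2 : ℝ × ℝ → WithLp 2 (ℝ × ℝ)) :=
    WithLp.measurable_toLp 2 (ℝ × ℝ)
  have hp (m : Measure (ℝ × ℝ)) [IsProbabilityMeasure m] :
      IsProbabilityMeasure (m.map (WithLp.toLp 2)) :=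
    Measure.isProbabilityMeasure_map hm.aemeasurable
  let P : ℕ → ProbabilityMeasure (WithLp 2 (ℝ × ℝ)) :=
    fun n => ⟨(ν n).map (WithLp.toLp 2), hp _⟩
  let P₀ : ProbabilityMeasure (WithLp 2 (ℝ × ℝ)) := ⟨ν₀.map (WithLp.toLp 2), hp _⟩
  have hP : Tendsto P atTop (𝓝 P₀) := by
    refine ProbabilityMeasure.tendsto_of_tendsto_charFun fun t => ?_
    simpa only [P, P₀, ProbabilityMeasure.coe_mk, charFun_map_toLp] using h t.fst t.snd
  have hc : Continuous (WithLp.ofLp : WithLp 2 (ℝ × ℝ) → ℝ × ℝ) :=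
    WithLp.prod_continuous_ofLp 2 ℝ ℝ
  have hQ := ProbabilityMeasure.tendsto_map_of_tendsto_of_continuous P P₀ hP hc
  have back (m : Measure (ℝ × ℝ)) : (m.map (WithLp.toLp 2)).map WithLp.ofLp = m := by
    rw [Measure.map_map hc.measurable hm]
    exact Measure.map_id
  have hQ₀ : (P₀.map hc.measurable.aemeasurable : Measure (ℝ × ℝ)) = ν₀ := back ν₀
  have hQn (n : ℕ) : ((P n).map hc.measurable.aemeasurable : Measure (ℝ × ℝ)) = ν n := back (ν n)
  have hlim := ProbabilityMeasure.tendsto_measure_of_null_frontier_of_tendsto' hQ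
    (E := E) (by rwa [hQ₀])
  simp only [hQ₀, hQn] at hlim
  exact (ENNReal.tendsto_toReal (measure_ne_top _ _)).comp hlim

end LevyPlane

section GaussTwo

open Topology

instance isProbabilityMeasure_gauss2 (ρ : ℝ) : IsProbabilityMeasure (gauss2 ρ) :=
  Measure.isProbabilityMeasure_map (by fun_prop)

lemma integral_cexp_gauss2 {ρ : ℝ} (hρ : ρ ^ 2 ≤ 1) (t₁ t₂ : ℝ) :
    ∫ q : ℝ × ℝ, Complex.exp (((t₁ * q.1 + t₂ * q.2 : ℝ) : ℂ) * Complex.I) ∂(gauss2 ρ) =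
      Complex.exp (-((t₁ ^ 2 + 2 * ρ * t₁ * t₂ + t₂ ^ 2 : ℝ) : ℂ) / 2) := by
  rw [gauss2, integral_map (by fun_prop) (by fun_prop)]
  have key := (charFun_map_toLp ((gaussianReal 0 1).prod (gaussianReal 0 1))
    (WithLp.toLp 2 (t₁ + ρ * t₂, Real.sqrt (1 - ρ ^ 2) * t₂))).symm
  rw [charFun_prod] at key
  have hs : Real.sqrt (1 - ρ ^ 2) ^ 2 = 1 - ρ ^ 2 := Real.sq_sqrt (by linarith)
  calc _ = _ := by
        congr 1
        ext q
        congr 3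
        simp
        ring
    _ = _ := key
    _ = _ := by
        simp only [charFun_gaussianReal]
        rw [← Complex.exp_add]
        congr 1
        simp only [NNReal.coe_one, Complex.ofReal_zero, mul_zero, zero_mul, Complex.ofReal_one,
          one_mul, zero_sub]
        rw [← sub_eq_zero]
        have hs' : ((Real.sqrt (1 - ρ ^ 2) : ℝ) : ℂ) ^ 2 = 1 - (ρ : ℂ) ^ 2 := by
          exact_mod_cast congrArg (fun x : ℝ => (x : ℂ)) hs
        push_cast
        linear_combination (-(t₂ : ℂ) ^ 2 / 2) * hs'

lemma map_fst_gauss2 (ρ : ℝ) : (gauss2 ρ).map Prod.fst = gaussianReal 0 1 := by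
  rw [gauss2, Measure.map_map (by fun_prop) (by fun_prop)]
  exact Measure.fst_prod

lemma map_snd_gauss2 {ρ : ℝ} (hρ : ρ ^ 2 ≤ 1) : (gauss2 ρ).map Prod.snd = gaussianReal 0 1 := by
  have := Measure.isProbabilityMeasure_map (μ := gauss2 ρ) measurable_snd.aemeasurable
  refine Measure.ext_of_charFun (funext fun t => ?_)
  rw [charFun_apply_real, integral_map (by fun_prop) (by fun_prop), charFun_gaussianReal]
  have := integral_cexp_gauss2 hρ 0 t
  simp only [zero_mul, zero_add] at this
  push_cast at this
  rw [this]
  congr 1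
  push_cast
  ring

lemma gauss2_zero : gauss2 0 = (gaussianReal 0 1).prod (gaussianReal 0 1) := by
  simp [gauss2]

end GaussTwo

section DiscreteLaw

open Topology

variable {Ω : Type*} [Fintype Ω]

/-- The law of `S : Ω → E` when the finite type `Ω` carries the weights `p`. -/
def discreteLaw {E : Type*} [MeasurableSpace E] (p : Ω → ℝ) (S : Ω → E) : Measure E :=
  ∑ ω, ENNReal.ofReal (p ω) • Measure.dirac (S ω)

lemma isProbabilityMeasure_discreteLaw {E : Type*} [MeasurableSpace E] {p : Ω → ℝ}
    (hp : IsDist p) (S : Ω → E) : IsProbabilityMeasure (discreteLaw p S) := by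
  constructor
  simp only [discreteLaw, Measure.coe_finsetSum, Finset.sum_apply, Measure.smul_apply,
    measure_univ, smul_eq_mul, mul_one]
  rw [← ENNReal.ofReal_sum_of_nonneg fun ω _ => hp.1 ω, hp.2, ENNReal.ofReal_one]

lemma integral_discreteLaw {E F : Type*} [MeasurableSpace E] [MeasurableSingletonClass E]
    [NormedAddCommGroup F] [NormedSpace ℝ F] [CompleteSpace F] {p : Ω → ℝ}
    (hp : ∀ ω, 0 ≤ p ω) (S : Ω → E) (f : E → F) :
    ∫ x, f x ∂(discreteLaw p S) = ∑ ω, p ω • f (S ω) := by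
  have hint (ω : Ω) : Integrable f (Measure.dirac (S ω)) :=
    (integrable_dirac (by simp))
  rw [discreteLaw, integral_finsetSum_measure
    fun ω _ => (hint ω).smul_measure ENNReal.ofReal_ne_top]
  simp [integral_smul_measure, ENNReal.toReal_ofReal (hp _)]

lemma isDist_prodDist {p : Ω → ℝ} (hp : IsDist p) (n : ℕ) : IsDist (prodDist p n) := by
  refine ⟨fun z => Finset.prod_nonneg fun i _ => hp.1 _, ?_⟩
  simp only [prodDist]
  rw [← Fintype.sum_pow, hp.2, one_pow]

/-- The characteristic function of a normalized sum of i.i.d. centered finite variables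
converges to that of a centered Gaussian. -/
lemma tendsto_pow_sum_cexp {p : Ω → ℝ} (hp : IsDist p) {Z : Ω → ℝ} {v : ℝ}
    (h0 : pmean p Z = 0) (hv : pmean p (fun ω => Z ω ^ 2) = v) :
    Tendsto (fun n : ℕ => (∑ ω, p ω •
      Complex.exp ((((Real.sqrt n)⁻¹ * Z ω : ℝ) : ℂ) * Complex.I)) ^ n)
      atTop (𝓝 (Complex.exp (-(v : ℂ) / 2))) := by
  have hv0 : 0 ≤ v := hv ▸ Finset.sum_nonneg fun ω _ => mul_nonneg (hp.1 ω) (sq_nonneg _)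
  rcases hv0.eq_or_lt with rfl | hpos
  · have hz (ω : Ω) : p ω = 0 ∨ Z ω = 0 := by
      have := (Finset.sum_eq_zero_iff_of_nonneg
        fun ω _ => mul_nonneg (hp.1 ω) (sq_nonneg (Z ω))).1 hv ω (Finset.mem_univ ω)
      simpa using this
    have hone (n : ℕ) : ∑ ω, p ω •
        Complex.exp ((((Real.sqrt n)⁻¹ * Z ω : ℝ) : ℂ) * Complex.I) = 1 := by
      have : ∑ ω, ((p ω : ℝ) : ℂ) = 1 := by exact_mod_cast hp.2
      rw [← this]
      refine Finset.sum_congr rfl fun ω _ => ?_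
      rcases hz ω with h | h <;> simp [h]
    simp only [hone, one_pow]
    simp
  · set σ := Real.sqrt v with hσ
    have hσ0 : σ ≠ 0 := (Real.sqrt_pos.2 hpos).ne'
    have hσ2 : σ ^ 2 = v := Real.sq_sqrt hv0
    have := isProbabilityMeasure_discreteLaw hp fun ω => Z ω / σ
    have key := tendsto_charFun_inv_sqrt_mul_pow (P := discreteLaw p fun ω => Z ω / σ)
      (X := id) aemeasurable_id ?_ ?_ σ
    · have hc : Complex.exp (-(v : ℂ) / 2) = Complex.exp (-(σ : ℂ) ^ 2 / 2) := by
        rw [← hσ2]; push_cast; rfl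
      rw [hc]
      convert key using 3 with n
      rw [Measure.map_id, charFun_apply_real, integral_discreteLaw hp.1]
      refine Finset.sum_congr rfl fun ω _ => ?_
      congr 3
      push_cast
      have : (σ : ℂ) ≠ 0 := by exact_mod_cast hσ0
      field_simp
    · rw [integral_discreteLaw hp.1]
      have : ∑ ω, p ω * Z ω = 0 := h0
      simp only [id, smul_eq_mul, ← mul_div_assoc, ← Finset.sum_div, this, zero_div]
    · rw [integral_discreteLaw hp.1]
      have : ∑ ω, p ω * Z ω ^ 2 = v := hv
      simp only [Pi.pow_apply, id, smul_eq_mul, div_pow, ← mul_div_assoc, ← Finset.sum_div, this,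
        hσ2]
      exact div_self hpos.ne'

/-- The normalized sum `n^{-1/2} ∑ X(z_i)`. -/
def normSum (X : Ω → ℝ) {n : ℕ} (z : Fin n → Ω) : ℝ := (Real.sqrt n)⁻¹ * ∑ i, X (z i)

/-- The central limit theorem for a `ρ`-correlated pair of standardized variables on a finite
probability space. -/
lemma tendsto_measureReal_normSum {p : Ω → ℝ} (hp : IsDist p) {X Y : Ω → ℝ} {ρ : ℝ}
    (hρ : ρ ^ 2 ≤ 1) (hX : pmean p X = 0) (hY : pmean p Y = 0)
    (hX2 : pmean p (fun ω => X ω ^ 2) = 1) (hY2 : pmean p (fun ω => Y ω ^ 2) = 1)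
    (hXY : pmean p (fun ω => X ω * Y ω) = ρ) {E : Set (ℝ × ℝ)}
    (hE : gauss2 ρ (frontier E) = 0) :
    Tendsto (fun n : ℕ => (discreteLaw (prodDist p n)
      fun z => (normSum X z, normSum Y z)).real E) atTop (𝓝 ((gauss2 ρ).real E)) := by
  have (n : ℕ) := isProbabilityMeasure_discreteLaw (isDist_prodDist hp n)
    fun z : Fin n → Ω => (normSum X z, normSum Y z)
  refine tendsto_measureReal_of_tendsto_charFun (fun t₁ t₂ => ?_) hE
  rw [integral_cexp_gauss2 hρ]
  have h0 : pmean p (fun ω => t₁ * X ω + t₂ * Y ω) = 0 := by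
    have : pmean p (fun ω => t₁ * X ω + t₂ * Y ω) = t₁ * pmean p X + t₂ * pmean p Y := by
      simp only [pmean, Finset.mul_sum, ← Finset.sum_add_distrib]
      exact Finset.sum_congr rfl fun ω _ => by ring
    rw [this, hX, hY]; ring
  have hv : pmean p (fun ω => (t₁ * X ω + t₂ * Y ω) ^ 2) =
      t₁ ^ 2 + 2 * ρ * t₁ * t₂ + t₂ ^ 2 := by
    have : pmean p (fun ω => (t₁ * X ω + t₂ * Y ω) ^ 2) =
        t₁ ^ 2 * pmean p (fun ω => X ω ^ 2) + 2 * pmean p (fun ω => X ω * Y ω) * t₁ * t₂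
          + t₂ ^ 2 * pmean p (fun ω => Y ω ^ 2) := by
      simp only [pmean, Finset.mul_sum, Finset.sum_mul, ← Finset.sum_add_distrib]
      exact Finset.sum_congr rfl fun ω _ => by ring
    rw [this, hX2, hY2, hXY]; ring
  convert tendsto_pow_sum_cexp hp h0 hv using 2 with n
  rw [integral_discreteLaw (isDist_prodDist hp n).1, Fintype.sum_pow]
  refine Finset.sum_congr rfl fun z _ => ?_
  simp only [prodDist, Complex.real_smul, Finset.prod_mul_distrib, ← Complex.exp_sum]
  push_cast
  congr 2
  simp only [normSum]
  push_cast
  simp only [Finset.mul_sum, Finset.sum_mul, ← Finset.sum_add_distrib]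
  exact Finset.sum_congr rfl fun i _ => by ring

end DiscreteLaw

section Threshold

open Topology

lemma thr_eq_indicator (t r : ℝ) : thr t r = 2 * (Set.Ici t).indicator 1 r - 1 := by
  by_cases h : t ≤ r <;> simp [thr, h]; norm_num

lemma thr_mem_Icc (t r : ℝ) : thr t r ∈ Set.Icc (-1 : ℝ) 1 := by
  unfold thr; split_ifs <;> norm_num

lemma abs_thr (t r : ℝ) : |thr t r| = 1 := by
  unfold thr; split_ifs <;> simp

lemma measurable_thr (t : ℝ) : Measurable (thr t) :=
  Measurable.ite measurableSet_Ici measurable_const measurable_const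

lemma thr_le_thr {s t : ℝ} (h : s ≤ t) (r : ℝ) : thr t r ≤ thr s r := by
  by_cases h₁ : t ≤ r
  · simp [thr, h₁, h.trans h₁]
  · simpa [thr, h₁] using (thr_mem_Icc s r).1

lemma integrable_thr_comp {E : Type*} [MeasurableSpace E] {L : Measure E} [IsFiniteMeasure L]
    {X : E → ℝ} (hX : Measurable X) (t : ℝ) : Integrable (fun x => thr t (X x)) L :=
  Integrable.of_bound ((measurable_thr t).comp hX).aestronglyMeasurable 1
    (ae_of_all _ fun x => (abs_thr t (X x)).le)

lemma integral_thr_comp {E : Type*} [MeasurableSpace E] (L : Measure E)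
    [IsProbabilityMeasure L] {X : E → ℝ} (hX : Measurable X) (t : ℝ) :
    ∫ x, thr t (X x) ∂L = 2 * L.real {x | t ≤ X x} - 1 := by
  have hm : MeasurableSet {x | t ≤ X x} := hX measurableSet_Ici
  have (x : E) : thr t (X x) = 2 * {x | t ≤ X x}.indicator 1 x - 1 := thr_eq_indicator t (X x)
  simp only [this]
  have i₁ : Integrable (fun x => 2 * {x | t ≤ X x}.indicator (1 : E → ℝ) x) L :=
    ((integrable_const (1 : ℝ)).indicator hm).const_mul 2
  rw [integral_sub i₁ (integrable_const _), integral_const_mul, integral_indicator_one hm]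
  simp

lemma integral_thr_mul_thr {E : Type*} [MeasurableSpace E] (L : Measure E)
    [IsProbabilityMeasure L] {X Y : E → ℝ} (hX : Measurable X) (hY : Measurable Y) (s t : ℝ) :
    ∫ x, thr s (X x) * thr t (Y x) ∂L =
      4 * L.real ({x | s ≤ X x} ∩ {x | t ≤ Y x}) - ∫ x, thr s (X x) ∂L
        - ∫ x, thr t (Y x) ∂L - 1 := by
  have hm : MeasurableSet ({x | s ≤ X x} ∩ {x | t ≤ Y x}) :=
    (hX measurableSet_Ici).inter (hY measurableSet_Ici)
  have (x : E) : thr s (X x) * thr t (Y x) =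
      4 * ({x | s ≤ X x} ∩ {x | t ≤ Y x}).indicator 1 x - thr s (X x) - thr t (Y x) - 1 := by
    by_cases h₁ : s ≤ X x <;> by_cases h₂ : t ≤ Y x <;> simp [thr, h₁, h₂]; norm_num
  have i₁ : Integrable (fun x => 4 * ({x | s ≤ X x} ∩ {x | t ≤ Y x}).indicator (1 : E → ℝ) x) L :=
    ((integrable_const (1 : ℝ)).indicator hm).const_mul 4
  have i₂ := integrable_thr_comp (L := L) hX s
  have i₃ := integrable_thr_comp (L := L) hY t
  have i₁₂ : Integrable (fun x => 4 * ({x | s ≤ X x} ∩ {x | t ≤ Y x}).indicator (1 : E → ℝ) x -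
      thr s (X x)) L := i₁.sub i₂
  have i₁₂₃ : Integrable (fun x => 4 * ({x | s ≤ X x} ∩ {x | t ≤ Y x}).indicator (1 : E → ℝ) x -
      thr s (X x) - thr t (Y x)) L := i₁₂.sub i₃
  simp only [this]
  rw [integral_sub i₁₂₃ (integrable_const _), integral_sub i₁₂ i₃,
    integral_sub i₁ i₂, integral_const_mul, integral_indicator_one hm]
  simp

lemma integral_fst_gauss2 (ρ : ℝ) {F : ℝ → ℝ} (hF : Measurable F) :
    ∫ q, F q.1 ∂(gauss2 ρ) = ∫ r, F r ∂(gaussianReal 0 1) := by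
  rw [← map_fst_gauss2 ρ, integral_map (by fun_prop) hF.aestronglyMeasurable]

lemma integral_snd_gauss2 {ρ : ℝ} (hρ : ρ ^ 2 ≤ 1) {F : ℝ → ℝ} (hF : Measurable F) :
    ∫ q, F q.2 ∂(gauss2 ρ) = ∫ r, F r ∂(gaussianReal 0 1) := by
  rw [← map_snd_gauss2 hρ, integral_map (by fun_prop) hF.aestronglyMeasurable]

lemma gauss2_frontier_le_fst (ρ s : ℝ) : gauss2 ρ (frontier {q : ℝ × ℝ | s ≤ q.1}) = 0 := by
  refine measure_mono_null (t := Prod.fst ⁻¹' {s}) (fun q hq => ?_) ?_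
  · exact (frontier_le_subset_eq continuous_const continuous_fst hq).symm
  · have := nullSingletonClass_gaussianReal (μ := 0) one_ne_zero
    rw [← Measure.map_apply measurable_fst (measurableSet_singleton s), map_fst_gauss2,
      measure_singleton]

lemma gauss2_frontier_le_snd {ρ : ℝ} (hρ : ρ ^ 2 ≤ 1) (t : ℝ) :
    gauss2 ρ (frontier {q : ℝ × ℝ | t ≤ q.2}) = 0 := by
  refine measure_mono_null (t := Prod.snd ⁻¹' {t}) (fun q hq => ?_) ?_
  · exact (frontier_le_subset_eq continuous_const continuous_snd hq).symm
  · have := nullSingletonClass_gaussianReal (μ := 0) one_ne_zero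
    rw [← Measure.map_apply measurable_snd (measurableSet_singleton t), map_snd_gauss2 hρ,
      measure_singleton]

lemma tendsto_pmean_thr_normSum {Ω : Type*} [Fintype Ω] {p : Ω → ℝ} (hp : IsDist p)
    {X Y : Ω → ℝ} {ρ : ℝ} (hρ : ρ ^ 2 ≤ 1) (hX : pmean p X = 0) (hY : pmean p Y = 0)
    (hX2 : pmean p (fun ω => X ω ^ 2) = 1) (hY2 : pmean p (fun ω => Y ω ^ 2) = 1)
    (hXY : pmean p (fun ω => X ω * Y ω) = ρ) (s t : ℝ) :
    Tendsto (fun n : ℕ => pmean (prodDist p n) fun z => thr s (normSum X z)) atTop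
        (𝓝 (∫ r, thr s r ∂(gaussianReal 0 1))) ∧
      Tendsto (fun n : ℕ => pmean (prodDist p n) fun z => thr t (normSum Y z)) atTop
        (𝓝 (∫ r, thr t r ∂(gaussianReal 0 1))) ∧
      Tendsto (fun n : ℕ => pmean (prodDist p n)
          fun z => thr s (normSum X z) * thr t (normSum Y z)) atTop
        (𝓝 (∫ q : ℝ × ℝ, thr s q.1 * thr t q.2 ∂(gauss2 ρ))) := by
  have hclt {E : Set (ℝ × ℝ)} (hE : gauss2 ρ (frontier E) = 0) :=
    tendsto_measureReal_normSum hp hρ hX hY hX2 hY2 hXY hE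
  have hprob (n : ℕ) := isProbabilityMeasure_discreteLaw (isDist_prodDist hp n)
    fun z : Fin n → Ω => (normSum X z, normSum Y z)
  have hpmean (n : ℕ) (F : ℝ × ℝ → ℝ) :
      pmean (prodDist p n) (fun z => F (normSum X z, normSum Y z)) =
        ∫ q, F q ∂(discreteLaw (prodDist p n) fun z => (normSum X z, normSum Y z)) := by
    rw [integral_discreteLaw (isDist_prodDist hp n).1]
    rfl
  have h₁ : Tendsto (fun n : ℕ => pmean (prodDist p n) fun z => thr s (normSum X z)) atTop
      (𝓝 (∫ q : ℝ × ℝ, thr s q.1 ∂(gauss2 ρ))) := by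
    simp only [fun n => hpmean n fun q => thr s q.1, integral_thr_comp _ measurable_fst]
    exact ((hclt (gauss2_frontier_le_fst ρ s)).const_mul 2).sub_const 1
  have h₂ : Tendsto (fun n : ℕ => pmean (prodDist p n) fun z => thr t (normSum Y z)) atTop
      (𝓝 (∫ q : ℝ × ℝ, thr t q.2 ∂(gauss2 ρ))) := by
    simp only [fun n => hpmean n fun q => thr t q.2, integral_thr_comp _ measurable_snd]
    exact ((hclt (gauss2_frontier_le_snd hρ t)).const_mul 2).sub_const 1
  refine ⟨by rwa [integral_fst_gauss2 ρ (measurable_thr s)] at h₁,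
    by rwa [integral_snd_gauss2 hρ (measurable_thr t)] at h₂, ?_⟩
  have h₃ := hclt (null_frontier_inter (gauss2_frontier_le_fst ρ s) (gauss2_frontier_le_snd hρ t))
  rw [integral_thr_mul_thr _ measurable_fst measurable_snd]
  simp only [fun n => hpmean n fun q => thr s q.1, fun n => hpmean n fun q => thr t q.2] at h₁ h₂
  simp only [fun n => hpmean n fun q => thr s q.1 * thr t q.2,
    integral_thr_mul_thr _ measurable_fst measurable_snd]
  exact (((h₃.const_mul 4).sub h₁).sub h₂).sub_const 1

lemma integral_thr_mem_Icc (L : Measure ℝ) [IsProbabilityMeasure L] (t : ℝ) :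
    ∫ r, thr t r ∂L ∈ Set.Icc (-1 : ℝ) 1 := by
  have h : ‖∫ r, thr t r ∂L‖ ≤ 1 * L.real Set.univ :=
    norm_integral_le_of_norm_le_const (ae_of_all _ fun r => (abs_thr t r).le)
  rw [probReal_univ, mul_one, Real.norm_eq_abs] at h
  exact abs_le.1 h

lemma integral_abs_thr_sub_thr {L : Measure ℝ} [IsFiniteMeasure L] (s t : ℝ) :
    ∫ r, |thr s r - thr t r| ∂L = |∫ r, thr s r ∂L - ∫ r, thr t r ∂L| := by
  have hs := integrable_thr_comp (L := L) measurable_id s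
  have ht := integrable_thr_comp (L := L) measurable_id t
  wlog h : s ≤ t generalizing s t
  · rw [abs_sub_comm, ← this t s ht hs (le_of_not_ge h)]
    simp only [abs_sub_comm]
  have hpt (r : ℝ) : 0 ≤ thr s r - thr t r := sub_nonneg.2 (thr_le_thr h r)
  simp only [id] at hs ht
  rw [← integral_sub hs ht, abs_of_nonneg (integral_nonneg hpt)]
  simp only [abs_of_nonneg (hpt _)]

/-- Thresholds can be rounded to a finite set while changing the mean by at most `ε`. -/
lemma exists_threshold_rounding (L : Measure ℝ) [IsProbabilityMeasure L] {ε : ℝ} (hε : 0 < ε) :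
    ∃ rd : ℝ → ℝ, (Set.range rd).Finite ∧
      ∀ s, |∫ r, thr (rd s) r ∂L - ∫ r, thr s r ∂L| ≤ ε := by
  have hb : TotallyBounded (Set.range fun s => ∫ r, thr s r ∂L) :=
    (totallyBounded_Icc (-1) 1).subset (Set.range_subset_iff.2 (integral_thr_mem_Icc L))
  obtain ⟨T, hTs, hT, hcov⟩ := Metric.finite_approx_of_totallyBounded hb ε hε
  choose! g hg using fun y (hy : y ∈ T) => hTs hy
  have hex (s : ℝ) : ∃ y ∈ T, |y - ∫ r, thr s r ∂L| ≤ ε := by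
    obtain ⟨y, hy, hd⟩ := Set.mem_iUnion₂.1 (hcov ⟨s, rfl⟩)
    rw [Metric.mem_ball, dist_comm, Real.dist_eq] at hd
    exact ⟨y, hy, hd.le⟩
  choose y hy hd using hex
  refine ⟨fun s => g (y s), (hT.image g).subset ?_, fun s => ?_⟩
  · rintro _ ⟨s, rfl⟩
    exact Set.mem_image_of_mem g (hy s)
  · have := hg (y s) (hy s)
    simp only at this
    rw [this]
    exact hd s

lemma abs_integral_gauss2_thr_sub_le {ρ : ℝ} (hρ : ρ ^ 2 ≤ 1) (s s' t t' : ℝ) :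
    |∫ q : ℝ × ℝ, thr s q.1 * thr t q.2 ∂(gauss2 ρ) -
        ∫ q : ℝ × ℝ, thr s' q.1 * thr t' q.2 ∂(gauss2 ρ)| ≤
      |∫ r, thr s r ∂(gaussianReal 0 1) - ∫ r, thr s' r ∂(gaussianReal 0 1)| +
        |∫ r, thr t r ∂(gaussianReal 0 1) - ∫ r, thr t' r ∂(gaussianReal 0 1)| := by
  have hprod (s t : ℝ) : Integrable (fun q : ℝ × ℝ => thr s q.1 * thr t q.2) (gauss2 ρ) :=
    (integrable_thr_comp measurable_snd t).bdd_mul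
      ((measurable_thr s).comp measurable_fst).aestronglyMeasurable
      (ae_of_all _ fun q => (abs_thr s q.1).le)
  have hs : Integrable (fun q : ℝ × ℝ => |thr s q.1 - thr s' q.1|) (gauss2 ρ) :=
    ((integrable_thr_comp measurable_fst s).sub (integrable_thr_comp measurable_fst s')).abs
  have ht : Integrable (fun q : ℝ × ℝ => |thr t q.2 - thr t' q.2|) (gauss2 ρ) :=
    ((integrable_thr_comp measurable_snd t).sub (integrable_thr_comp measurable_snd t')).abs
  have hm (s s' : ℝ) : Measurable fun r => |thr s r - thr s' r| :=
    ((measurable_thr s).sub (measurable_thr s')).abs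
  rw [← integral_abs_thr_sub_thr, ← integral_abs_thr_sub_thr,
    ← integral_fst_gauss2 ρ (hm s s'), ← integral_snd_gauss2 hρ (hm t t'),
    ← integral_add hs ht, ← integral_sub (hprod s t) (hprod s' t')]
  refine abs_integral_le_integral_abs.trans
    (integral_mono ((hprod s t).sub (hprod s' t')).abs (hs.add ht) fun q => ?_)
  calc |thr s q.1 * thr t q.2 - thr s' q.1 * thr t' q.2|
      = |(thr s q.1 - thr s' q.1) * thr t q.2 + thr s' q.1 * (thr t q.2 - thr t' q.2)| := by
        congr 1; ring
    _ ≤ _ := (abs_add_le _ _).trans_eq (by simp only [abs_mul, abs_thr, mul_one, one_mul])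

end Threshold

section FiniteExpectation

lemma pmean_sub {Ω : Type*} [Fintype Ω] (p F G : Ω → ℝ) :
    pmean p F - pmean p G = pmean p (fun ω => F ω - G ω) := by
  simp only [pmean, ← Finset.sum_sub_distrib, mul_sub]

lemma abs_pmean_sub_pmean_le {Ω : Type*} [Fintype Ω] {p : Ω → ℝ} (hp : IsDist p)
    {F G : Ω → ℝ} {ε : ℝ} (h : ∀ ω, |F ω - G ω| ≤ ε) : |pmean p F - pmean p G| ≤ ε := by
  rw [pmean_sub]
  calc |pmean p (fun ω => F ω - G ω)| ≤ ∑ ω, |p ω * (F ω - G ω)| :=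
        Finset.abs_sum_le_sum_abs _ _
    _ ≤ ∑ ω, p ω * ε := Finset.sum_le_sum fun ω _ => by
        rw [abs_mul, abs_of_nonneg (hp.1 ω)]
        exact mul_le_mul_of_nonneg_left (h ω) (hp.1 ω)
    _ = ε := by rw [← Finset.sum_mul, hp.2, one_mul]

variable {A B : Type*} [Fintype A] [Fintype B]

lemma pmean_marginalA (μ : A × B → ℝ) (f : A → ℝ) :
    pmean (marginalA μ) f = pmean μ (fun ab => f ab.1) := by
  simp [pmean, marginalA, Fintype.sum_prod_type, Finset.sum_mul]

lemma pmean_marginalB (μ : A × B → ℝ) (g : B → ℝ) :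
    pmean (marginalB μ) g = pmean μ (fun ab => g ab.2) := by
  simp [pmean, marginalB, Fintype.sum_prod_type_right, Finset.sum_mul]

lemma isDist_marginalA {μ : A × B → ℝ} (hμ : IsDist μ) : IsDist (marginalA μ) :=
  ⟨fun _ => Finset.sum_nonneg fun _ _ => hμ.1 _, by
    rw [← hμ.2, Fintype.sum_prod_type]; rfl⟩

lemma isDist_marginalB {μ : A × B → ℝ} (hμ : IsDist μ) : IsDist (marginalB μ) :=
  ⟨fun _ => Finset.sum_nonneg fun _ _ => hμ.1 _, by
    rw [← hμ.2, Fintype.sum_prod_type_right]; rfl⟩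

lemma pmean_prodPair (μ : A × B → ℝ) (n : ℕ) (F : (Fin n → A) × (Fin n → B) → ℝ) :
    pmean (prodPair μ n) F =
      pmean (prodDist μ n) (fun z => F (fun i => (z i).1, fun i => (z i).2)) :=
  (Equiv.sum_comp (Equiv.arrowProdEquivProdArrow (Fin n) (fun _ => A) (fun _ => B))
    fun p => prodPair μ n p * F p).symm

lemma marginalA_prodPair (μ : A × B → ℝ) (n : ℕ) :
    marginalA (prodPair μ n) = prodDist (marginalA μ) n := by
  ext x
  simp only [marginalA, prodPair, prodDist]
  exact (Fintype.prod_sum fun i b => μ (x i, b)).symm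

lemma marginalB_prodPair (μ : A × B → ℝ) (n : ℕ) :
    marginalB (prodPair μ n) = prodDist (marginalB μ) n := by
  ext y
  simp only [marginalB, prodPair, prodDist]
  exact (Fintype.prod_sum fun i a => μ (a, y i)).symm

lemma pmean_prodDist_marginalA (μ : A × B → ℝ) (n : ℕ) (F : (Fin n → A) → ℝ) :
    pmean (prodDist (marginalA μ) n) F = pmean (prodDist μ n) (fun z => F fun i => (z i).1) := by
  rw [← marginalA_prodPair, pmean_marginalA, pmean_prodPair]

lemma pmean_prodDist_marginalB (μ : A × B → ℝ) (n : ℕ) (F : (Fin n → B) → ℝ) :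
    pmean (prodDist (marginalB μ) n) F = pmean (prodDist μ n) (fun z => F fun i => (z i).2) := by
  rw [← marginalB_prodPair, pmean_marginalB, pmean_prodPair]

lemma pmean_prodDist_add {Ω : Type*} [Fintype Ω] (p : Ω → ℝ) (h w : ℕ)
    (F : (Fin (h + w) → Ω) → ℝ) :
    pmean (prodDist p (h + w)) F =
      pmean (prodDist p h) fun z₁ => pmean (prodDist p w) fun z₂ => F (Fin.append z₁ z₂) := by
  simp only [pmean, Finset.mul_sum]
  rw [← Equiv.sum_comp (Fin.appendEquiv h w), Fintype.sum_prod_type]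
  refine Finset.sum_congr rfl fun z₁ _ => Finset.sum_congr rfl fun z₂ _ => ?_
  simp [Fin.appendEquiv, prodDist, Fin.prod_univ_add, mul_assoc]

end FiniteExpectation

section MaximalCorrelation

/-- The standardized functions on `(Ω, p)` that vanish on the null atoms. -/
def standardized {Ω : Type*} [Fintype Ω] (p : Ω → ℝ) : Set (Ω → ℝ) :=
  {f | pmean p f = 0 ∧ pmean p (fun ω => f ω ^ 2) = 1 ∧ ∀ ω, p ω = 0 → f ω = 0}

lemma isCompact_standardized {Ω : Type*} [Fintype Ω] {p : Ω → ℝ} (hp : ∀ ω, 0 ≤ p ω) :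
    IsCompact (standardized p) := by
  have hc : IsClosed (standardized p) := by
    have h₁ : IsClosed {f : Ω → ℝ | pmean p f = 0} :=
      isClosed_eq (by unfold pmean; fun_prop) continuous_const
    have h₂ : IsClosed {f : Ω → ℝ | pmean p (fun ω => f ω ^ 2) = 1} :=
      isClosed_eq (by unfold pmean; fun_prop) continuous_const
    have h₃ : IsClosed {f : Ω → ℝ | ∀ ω, p ω = 0 → f ω = 0} := by
      simp only [Set.ofPred_forall]
      exact isClosed_iInter fun ω => isClosed_iInter fun _ =>
        isClosed_eq (continuous_apply ω) continuous_const
    exact h₁.inter (h₂.inter h₃)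
  refine (isCompact_univ_pi fun ω => isCompact_Icc
    (a := -Real.sqrt (p ω)⁻¹) (b := Real.sqrt (p ω)⁻¹)).of_isClosed_subset hc ?_
  rintro f ⟨-, h2, h0⟩ ω -
  refine abs_le.1 (Real.abs_le_sqrt ?_)
  rcases (hp ω).eq_or_lt with h | h
  · simp [h0 ω h.symm, ← h]
  · rw [← div_one (f ω ^ 2), inv_eq_one_div, div_le_div_iff₀ one_pos h, one_mul, mul_comm, ← h2]
    exact Finset.single_le_sum (f := fun ω => p ω * f ω ^ 2)
      (fun ω _ => mul_nonneg (hp ω) (sq_nonneg _)) (Finset.mem_univ ω)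

lemma pvar_eq_of_pmean_eq_zero {Ω : Type*} [Fintype Ω] {p f : Ω → ℝ} (h : pmean p f = 0) :
    pvar p f = pmean p (fun ω => f ω ^ 2) := by
  simp [pvar, h]

lemma pmean_congr_of_ne_zero {Ω : Type*} [Fintype Ω] {p F G : Ω → ℝ}
    (h : ∀ ω, p ω ≠ 0 → F ω = G ω) : pmean p F = pmean p G :=
  Finset.sum_congr rfl fun ω _ => by
    by_cases h0 : p ω = 0
    · simp [h0]
    · rw [h ω h0]

lemma exists_mem_standardized {Ω : Type*} [Fintype Ω] {p f : Ω → ℝ}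
    (h0 : pmean p f = 0) (h1 : pvar p f = 1) :
    ∃ f' ∈ standardized p, ∀ ω, p ω ≠ 0 → f' ω = f ω := by
  refine ⟨fun ω => if p ω = 0 then 0 else f ω, ⟨?_, ?_, fun ω hω => by simp [hω]⟩,
    fun ω hω => by simp [hω]⟩
  · exact (pmean_congr_of_ne_zero fun ω hω => by simp [hω]).trans h0
  · rw [← h1, pvar_eq_of_pmean_eq_zero h0]
    exact pmean_congr_of_ne_zero fun ω hω => by simp [hω]

variable {A B : Type*} [Fintype A] [Fintype B]

/-- The maximal correlation is attained by standardized functions, unless one of the marginals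
admits none, in which case it is zero. -/
lemma maxCorr_eq_zero_or_exists {μ : A × B → ℝ} (hμ : IsDist μ) :
    maxCorr μ = 0 ∨ 0 ≤ maxCorr μ ∧ ∃ f : A → ℝ, ∃ g : B → ℝ,
      pmean (marginalA μ) f = 0 ∧ pmean (marginalB μ) g = 0 ∧
      pmean (marginalA μ) (fun a => f a ^ 2) = 1 ∧ pmean (marginalB μ) (fun b => g b ^ 2) = 1 ∧
      pmean μ (fun ab => f ab.1 * g ab.2) = maxCorr μ := by
  have hK : IsCompact (standardized (marginalA μ) ×ˢ standardized (marginalB μ)) :=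
    (isCompact_standardized (isDist_marginalA hμ).1).prod
      (isCompact_standardized (isDist_marginalB hμ).1)
  rcases (standardized (marginalA μ) ×ˢ standardized (marginalB μ)).eq_empty_or_nonempty
    with hne | hne
  · left
    refine (congrArg sSup (Set.eq_empty_of_forall_notMem ?_)).trans Real.sSup_empty
    rintro r ⟨f, g, hf0, hg0, hf1, hg1, -⟩
    obtain ⟨f', hf', -⟩ := exists_mem_standardized hf0 hf1
    obtain ⟨g', hg', -⟩ := exists_mem_standardized hg0 hg1
    exact (hne ▸ Set.mk_mem_prod hf' hg' : (f', g') ∈ (∅ : Set ((A → ℝ) × (B → ℝ))))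
  · right
    have hcont : Continuous fun p : (A → ℝ) × (B → ℝ) =>
        pmean μ (fun ab => p.1 ab.1 * p.2 ab.2) := by
      unfold pmean; fun_prop
    obtain ⟨⟨f, g⟩, ⟨⟨hf0, hf1, hfz⟩, hg0, hg1, hgz⟩, hmax⟩ :=
      hK.exists_isMaxOn hne hcont.continuousOn
    have hgreat : maxCorr μ = pmean μ (fun ab => f ab.1 * g ab.2) := by
      refine IsGreatest.csSup_eq ⟨⟨f, g, hf0, hg0, ?_, ?_, rfl⟩, ?_⟩
      · rwa [pvar_eq_of_pmean_eq_zero hf0]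
      · rwa [pvar_eq_of_pmean_eq_zero hg0]
      · rintro _ ⟨u, v, hu0, hv0, hu1, hv1, rfl⟩
        obtain ⟨u', hu', hu⟩ := exists_mem_standardized hu0 hu1
        obtain ⟨v', hv', hv⟩ := exists_mem_standardized hv0 hv1
        have : pmean μ (fun ab => u ab.1 * v ab.2) = pmean μ (fun ab => u' ab.1 * v' ab.2) := by
          refine pmean_congr_of_ne_zero fun ab hab => ?_
          have hpos : 0 < μ ab := lt_of_le_of_ne (hμ.1 ab) hab.symm
          have hA : 0 < marginalA μ ab.1 := hpos.trans_le <|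
            Finset.single_le_sum (f := fun b => μ (ab.1, b)) (fun _ _ => hμ.1 _)
              (Finset.mem_univ ab.2)
          have hB : 0 < marginalB μ ab.2 := hpos.trans_le <|
            Finset.single_le_sum (f := fun a => μ (a, ab.2)) (fun _ _ => hμ.1 _)
              (Finset.mem_univ ab.1)
          rw [hu _ hA.ne', hv _ hB.ne']
        rw [this]
        exact hmax (Set.mk_mem_prod hu' hv')
    have hneg : -pmean μ (fun ab => f ab.1 * g ab.2) ≤ pmean μ (fun ab => f ab.1 * g ab.2) := by
      have hf' : -f ∈ standardized (marginalA μ) := by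
        refine ⟨?_, by simpa using hf1, fun ω h => neg_eq_zero.2 (hfz ω h)⟩
        have : pmean (marginalA μ) (-f) = -pmean (marginalA μ) f := by simp [pmean]
        rw [this, hf0, neg_zero]
      have := hmax (Set.mk_mem_prod hf' ⟨hg0, hg1, hgz⟩)
      simpa [pmean] using this
    exact ⟨by rw [hgreat]; linarith, f, g, hf0, hg0, hf1, hg1, hgreat.symm⟩

end MaximalCorrelation

/-- A single sample size makes the central limit approximation `ε`-accurate simultaneously for
all thresholds in a finite set. -/
lemma exists_forall_thr_normSum_close {Ω : Type*} [Fintype Ω] {p : Ω → ℝ} (hp : IsDist p)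
    {X Y : Ω → ℝ} {ρ : ℝ} (hρ : ρ ^ 2 ≤ 1) (hX : pmean p X = 0) (hY : pmean p Y = 0)
    (hX2 : pmean p (fun ω => X ω ^ 2) = 1) (hY2 : pmean p (fun ω => Y ω ^ 2) = 1)
    (hXY : pmean p (fun ω => X ω * Y ω) = ρ) {T : Set ℝ} (hT : T.Finite) {ε : ℝ} (hε : 0 < ε) :
    ∃ w : ℕ, ∀ s ∈ T, ∀ t ∈ T,
      |pmean (prodDist p w) (fun z => thr s (normSum X z)) -
          ∫ r, thr s r ∂(gaussianReal 0 1)| ≤ ε ∧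
        |pmean (prodDist p w) (fun z => thr t (normSum Y z)) -
          ∫ r, thr t r ∂(gaussianReal 0 1)| ≤ ε ∧
        |pmean (prodDist p w) (fun z => thr s (normSum X z) * thr t (normSum Y z)) -
          ∫ q : ℝ × ℝ, thr s q.1 * thr t q.2 ∂(gauss2 ρ)| ≤ ε := by
  have close {u : ℕ → ℝ} {a : ℝ} (h : Tendsto u atTop (nhds a)) :
      ∀ᶠ n in atTop, |u n - a| ≤ ε := by
    filter_upwards [Metric.tendsto_nhds.1 h ε hε] with n hn
    exact (Real.dist_eq _ _ ▸ hn).le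
  refine Eventually.exists (f := atTop) ((eventually_all_finite hT).2 fun s _ =>
    (eventually_all_finite hT).2 fun t _ => ?_)
  obtain ⟨h₁, h₂, h₃⟩ := tendsto_pmean_thr_normSum hp hρ hX hY hX2 hY2 hXY s t
  exact (close h₁).and ((close h₂).and (close h₃))

/-- Witsenhausen's rounding (Lemma 8.1): threshold strategies `f₂, g₂` on `h`
samples plus one `ρ`-correlated Gaussian (determined by thresholds `f₂', g₂'`) can be replaced
by functions `f₃, g₃` on `h + w` samples from `μ`, changing each mean and the correlation by at
most `ζ`. -/
theorem stmt13 {A B : Type*} [Fintype A] [Fintype B] (μ : A × B → ℝ) (hμ : IsDist μ)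
    (hρ : maxCorr μ < 1) (ζ : ℝ) (hζ : 0 < ζ) :
    ∃ w : ℕ, ∀ h : ℕ, ∀ f₂' : (Fin h → A) → ℝ, ∀ g₂' : (Fin h → B) → ℝ,
      ∃ f₃ : (Fin (h + w) → A) → ℝ, ∃ g₃ : (Fin (h + w) → B) → ℝ,
        (∀ x, f₃ x ∈ Set.Icc (-1 : ℝ) 1) ∧ (∀ y, g₃ y ∈ Set.Icc (-1 : ℝ) 1) ∧
        |pmean (prodDist (marginalA μ) (h + w)) f₃ -
          ∑ x : Fin h → A, prodDist (marginalA μ) h x *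
            ∫ r : ℝ, thr (f₂' x) r ∂(gaussianReal 0 1)| ≤ ζ ∧
        |pmean (prodDist (marginalB μ) (h + w)) g₃ -
          ∑ y : Fin h → B, prodDist (marginalB μ) h y *
            ∫ r : ℝ, thr (g₂' y) r ∂(gaussianReal 0 1)| ≤ ζ ∧
        |pmean (prodPair μ (h + w)) (fun p => f₃ p.1 * g₃ p.2) -
          ∑ z : Fin h → A × B, (∏ i, μ (z i)) *
            ∫ q : ℝ × ℝ, thr (f₂' (fun i => (z i).1)) q.1 *
              thr (g₂' (fun i => (z i).2)) q.2 ∂(gauss2 (maxCorr μ))| ≤ ζ := by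
  rcases maxCorr_eq_zero_or_exists hμ with h0 | ⟨hnn, X, Y, hX, hY, hX2, hY2, hXY⟩
  · refine ⟨0, fun h f₂' g₂' => ⟨fun x => ∫ r, thr (f₂' x) r ∂(gaussianReal 0 1),
      fun y => ∫ r, thr (g₂' y) r ∂(gaussianReal 0 1), fun x => integral_thr_mem_Icc _ _,
      fun y => integral_thr_mem_Icc _ _, ?_, ?_, ?_⟩⟩
    · exact (abs_eq_zero.2 (sub_self _)).trans_le hζ.le
    · exact (abs_eq_zero.2 (sub_self _)).trans_le hζ.le
    · rw [h0, gauss2_zero, pmean_prodPair]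
      simp only [integral_prod_mul (thr _) (thr _)]
      exact (abs_eq_zero.2 (sub_self _)).trans_le hζ.le
  · have hρ2 : maxCorr μ ^ 2 ≤ 1 := by nlinarith
    obtain ⟨rd, hfin, hrd⟩ := exists_threshold_rounding (gaussianReal 0 1)
      (ε := ζ / 3) (by positivity)
    obtain ⟨w, hw⟩ := exists_forall_thr_normSum_close hμ hρ2
      (X := fun ab => X ab.1) (Y := fun ab => Y ab.2)
      (by rwa [← pmean_marginalA]) (by rwa [← pmean_marginalB])
      (by rwa [← pmean_marginalA μ fun a => X a ^ 2])
      (by rwa [← pmean_marginalB μ fun b => Y b ^ 2]) hXY hfin (ε := ζ / 3) (by positivity)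
    refine ⟨w, fun h f₂' g₂' => ⟨
      fun x => thr (rd (f₂' fun i => x (Fin.castAdd w i))) (normSum X fun i => x (Fin.natAdd h i)),
      fun y => thr (rd (g₂' fun i => y (Fin.castAdd w i))) (normSum Y fun i => y (Fin.natAdd h i)),
      fun x => thr_mem_Icc _ _, fun y => thr_mem_Icc _ _, ?_, ?_, ?_⟩⟩
    · have hmean : pmean (prodDist (marginalA μ) (h + w)) (fun x =>
          thr (rd (f₂' fun i => x (Fin.castAdd w i))) (normSum X fun i => x (Fin.natAdd h i))) =
          pmean (prodDist μ h) fun z => pmean (prodDist μ w) fun u =>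
            thr (rd (f₂' fun i => (z i).1)) (normSum (fun ab => X ab.1) u) := by
        rw [pmean_prodDist_marginalA, pmean_prodDist_add]
        simp only [Fin.append_left, Fin.append_right, normSum]
      have hgauss := pmean_prodDist_marginalA μ h
        fun x => ∫ r, thr (f₂' x) r ∂(gaussianReal 0 1)
      rw [pmean] at hgauss
      rw [hmean, hgauss]
      refine abs_pmean_sub_pmean_le (isDist_prodDist hμ h) fun z => ?_
      have h₁ := (hw (rd (f₂' fun i => (z i).1)) ⟨_, rfl⟩ (rd 0) ⟨_, rfl⟩).1
      have h₂ := hrd (f₂' fun i => (z i).1)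
      exact (abs_sub_le _ _ _).trans ((add_le_add h₁ h₂).trans (by linarith))
    · have hmean : pmean (prodDist (marginalB μ) (h + w)) (fun y =>
          thr (rd (g₂' fun i => y (Fin.castAdd w i))) (normSum Y fun i => y (Fin.natAdd h i))) =
          pmean (prodDist μ h) fun z => pmean (prodDist μ w) fun u =>
            thr (rd (g₂' fun i => (z i).2)) (normSum (fun ab => Y ab.2) u) := by
        rw [pmean_prodDist_marginalB, pmean_prodDist_add]
        simp only [Fin.append_left, Fin.append_right, normSum]
      have hgauss := pmean_prodDist_marginalB μ h
        fun y => ∫ r, thr (g₂' y) r ∂(gaussianReal 0 1)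
      rw [pmean] at hgauss
      rw [hmean, hgauss]
      refine abs_pmean_sub_pmean_le (isDist_prodDist hμ h) fun z => ?_
      have h₁ := (hw (rd 0) ⟨_, rfl⟩ (rd (g₂' fun i => (z i).2)) ⟨_, rfl⟩).2.1
      have h₂ := hrd (g₂' fun i => (z i).2)
      exact (abs_sub_le _ _ _).trans ((add_le_add h₁ h₂).trans (by linarith))
    · rw [pmean_prodPair, pmean_prodDist_add]
      simp only [Fin.append_left, Fin.append_right]
      refine abs_pmean_sub_pmean_le (isDist_prodDist hμ h) fun z => ?_
      have h₁ := (hw (rd (f₂' fun i => (z i).1)) ⟨_, rfl⟩ (rd (g₂' fun i => (z i).2)) ⟨_, rfl⟩).2.2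
      have h₂ := (abs_integral_gauss2_thr_sub_le hρ2 (rd (f₂' fun i => (z i).1))
        (f₂' fun i => (z i).1) (rd (g₂' fun i => (z i).2)) (g₂' fun i => (z i).2)).trans
        (add_le_add (hrd _) (hrd _))
      exact (abs_sub_le _ _ _).trans ((add_le_add h₁ h₂).trans (by linarith))

end NIS
end
end
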